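/- Every non-separable PPT state ρ of rank 4 on ℂ^3 ⊗ ℂ^3 is an edge state: there is no nonzero product vector φ ⊗ ψ such that φ ⊗ ψ lies in the range of ρ and the partially conjugated vector conj(φ) ⊗ ψ lies in the range of ρ^{T1}. -/

import Mathlib

open scoped ComplexConjugate ComplexOrder

/-- The standard Hermitian inner product, conjugate-linear in the first argument. -/
noncomputable def hinner {α : Type*} [Fintype α] (x y : α → ℂ) : ℂ :=
  ∑ a, conj (x a) * y a

/-- The product vector `φ ⊗ ψ` in `ℂ^n ⊗ ℂ^m`, identified with `Fin n × Fin m → ℂ`. -/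
noncomputable def prodVec {n m : ℕ} (φ : Fin n → ℂ) (ψ : Fin m → ℂ) :
    Fin n × Fin m → ℂ :=
  fun p => φ p.1 * ψ p.2

/-- The partial transpose with respect to the first subsystem:
`ρ^{T1}((i,j),(k,l)) = ρ((k,j),(i,l))`. -/
noncomputable def pt {n m : ℕ} (ρ : Matrix (Fin n × Fin m) (Fin n × Fin m) ℂ) :
    Matrix (Fin n × Fin m) (Fin n × Fin m) ℂ :=
  Matrix.of fun a b => ρ (b.1, a.2) (a.1, b.2)

/-- `ρ` is separable if it is a finite sum of projections `z z^*` onto product vectors. -/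
def Separable {n m : ℕ} (ρ : Matrix (Fin n × Fin m) (Fin n × Fin m) ℂ) : Prop :=
  ∃ (k : ℕ) (φ : Fin k → Fin n → ℂ) (ψ : Fin k → Fin m → ℂ),
    ρ = ∑ t, Matrix.vecMulVec (prodVec (φ t) (ψ t)) (star (prodVec (φ t) (ψ t)))

section PPT

open Matrix Kronecker

/-- Positive semidefinite with positive semidefinite partial transpose. -/
def IsPPT {n m : ℕ} (ρ : Matrix (Fin n × Fin m) (Fin n × Fin m) ℂ) : Prop :=
  ρ.PosSemidef ∧ (pt ρ).PosSemidef

/-- The action `ρ ↦ (S ⊗ T) ρ (S ⊗ T)ᴴ` of a local operator. -/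
noncomputable def loc {n m n' m' : ℕ} (S : Matrix (Fin n') (Fin n) ℂ)
    (T : Matrix (Fin m') (Fin m) ℂ) (ρ : Matrix (Fin n × Fin m) (Fin n × Fin m) ℂ) :
    Matrix (Fin n' × Fin m') (Fin n' × Fin m') ℂ :=
  (S ⊗ₖ T) * ρ * (S ⊗ₖ T)ᴴ

section Local

variable {n m n' m' n'' m'' : ℕ}

lemma loc_apply (S : Matrix (Fin n') (Fin n) ℂ) (T : Matrix (Fin m') (Fin m) ℂ)
    (ρ : Matrix (Fin n × Fin m) (Fin n × Fin m) ℂ) (x y : Fin n' × Fin m') :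
    loc S T ρ x y = ∑ b, ∑ a, S x.1 a.1 * T x.2 a.2 * ρ a b * star (S y.1 b.1 * T y.2 b.2) := by
  simp [loc, mul_apply, Finset.sum_mul]

lemma pt_loc (S : Matrix (Fin n') (Fin n) ℂ) (T : Matrix (Fin m') (Fin m) ℂ)
    (ρ : Matrix (Fin n × Fin m) (Fin n × Fin m) ℂ) :
    pt (loc S T ρ) = loc (S.map star) T (pt ρ) := by
  ext x y
  simp only [pt, of_apply, loc_apply]
  rw [← Fintype.sum_prod_type', ← Fintype.sum_prod_type']
  refine Fintype.sum_equiv ⟨fun p => ((p.2.1, p.1.2), (p.1.1, p.2.2)),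
    fun p => ((p.2.1, p.1.2), (p.1.1, p.2.2)), fun p => rfl, fun p => rfl⟩ _ _ fun p => ?_
  simp
  ring

lemma loc_loc (S : Matrix (Fin n'') (Fin n') ℂ) (T : Matrix (Fin m'') (Fin m') ℂ)
    (S' : Matrix (Fin n') (Fin n) ℂ) (T' : Matrix (Fin m') (Fin m) ℂ)
    (ρ : Matrix (Fin n × Fin m) (Fin n × Fin m) ℂ) :
    loc S T (loc S' T' ρ) = loc (S * S') (T * T') ρ := by
  simp only [loc, mul_kronecker_mul, conjTranspose_mul, Matrix.mul_assoc]

lemma loc_one_one (ρ : Matrix (Fin n × Fin m) (Fin n × Fin m) ℂ) : loc 1 1 ρ = ρ := by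
  simp [loc]

lemma loc_add (S : Matrix (Fin n') (Fin n) ℂ) (T : Matrix (Fin m') (Fin m) ℂ)
    (ρ σ : Matrix (Fin n × Fin m) (Fin n × Fin m) ℂ) :
    loc S T (ρ + σ) = loc S T ρ + loc S T σ := by
  simp only [loc, Matrix.mul_add, Matrix.add_mul]

lemma kronecker_mulVec_prodVec (S : Matrix (Fin n') (Fin n) ℂ) (T : Matrix (Fin m') (Fin m) ℂ)
    (φ : Fin n → ℂ) (ψ : Fin m → ℂ) :
    (S ⊗ₖ T) *ᵥ prodVec φ ψ = prodVec (S *ᵥ φ) (T *ᵥ ψ) := by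
  ext x
  simp only [mulVec, dotProduct, prodVec, kroneckerMap_apply, Fintype.sum_mul_sum,
    Fintype.sum_prod_type]
  exact Finset.sum_congr rfl fun _ _ => Finset.sum_congr rfl fun _ _ => by ring

lemma loc_vecMulVec (S : Matrix (Fin n') (Fin n) ℂ) (T : Matrix (Fin m') (Fin m) ℂ)
    (z : Fin n × Fin m → ℂ) :
    loc S T (vecMulVec z (star z)) =
      vecMulVec ((S ⊗ₖ T) *ᵥ z) (star ((S ⊗ₖ T) *ᵥ z)) := by
  rw [loc, mul_vecMulVec, vecMulVec_mul, star_mulVec]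

lemma IsPPT.loc {ρ : Matrix (Fin n × Fin m) (Fin n × Fin m) ℂ} (h : IsPPT ρ)
    (S : Matrix (Fin n') (Fin n) ℂ) (T : Matrix (Fin m') (Fin m) ℂ) : IsPPT (loc S T ρ) :=
  ⟨h.1.mul_mul_conjTranspose_same _, by
    rw [pt_loc]; exact h.2.mul_mul_conjTranspose_same _⟩

lemma Separable.loc {ρ : Matrix (Fin n × Fin m) (Fin n × Fin m) ℂ} (h : Separable ρ)
    (S : Matrix (Fin n') (Fin n) ℂ) (T : Matrix (Fin m') (Fin m) ℂ) : Separable (loc S T ρ) := by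
  obtain ⟨k, φ, ψ, rfl⟩ := h
  refine ⟨k, fun t => S *ᵥ φ t, fun t => T *ᵥ ψ t, ?_⟩
  simp only [← kronecker_mulVec_prodVec, ← loc_vecMulVec]
  simp only [_root_.loc, Matrix.mul_sum, Matrix.sum_mul]

/-- Separability may be tested after an invertible local change of basis. -/
lemma Separable.of_loc {ρ : Matrix (Fin n × Fin m) (Fin n × Fin m) ℂ}
    {S : Matrix (Fin n') (Fin n) ℂ} {T : Matrix (Fin m') (Fin m) ℂ}
    (S' : Matrix (Fin n) (Fin n') ℂ) (T' : Matrix (Fin m) (Fin m') ℂ)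
    (hS : S' * S = 1) (hT : T' * T = 1) (h : Separable (_root_.loc S T ρ)) : Separable ρ := by
  simpa [loc_loc, hS, hT, loc_one_one] using h.loc S' T'

lemma Separable.add {ρ σ : Matrix (Fin n × Fin m) (Fin n × Fin m) ℂ} (hρ : Separable ρ)
    (hσ : Separable σ) : Separable (ρ + σ) := by
  obtain ⟨k, φ, ψ, rfl⟩ := hρ
  obtain ⟨l, φ', ψ', rfl⟩ := hσ
  exact ⟨k + l, Fin.append φ φ', Fin.append ψ ψ', by simp [Fin.sum_univ_add]⟩

lemma separable_prodVec (φ : Fin n → ℂ) (ψ : Fin m → ℂ) :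
    Separable (vecMulVec (prodVec φ ψ) (star (prodVec φ ψ))) :=
  ⟨1, fun _ => φ, fun _ => ψ, by simp⟩

lemma Separable.smul {ρ : Matrix (Fin n × Fin m) (Fin n × Fin m) ℂ} (hρ : Separable ρ)
    {c : ℝ} (hc : 0 ≤ c) : Separable ((c : ℂ) • ρ) := by
  have h := hρ.loc (((√c : ℝ) : ℂ) • (1 : Matrix (Fin n) (Fin n) ℂ)) (1 : Matrix (Fin m) (Fin m) ℂ)
  convert h using 1
  ext x y
  simp only [_root_.loc, smul_kronecker, one_kronecker_one, conjTranspose_smul, smul_mul,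
    Matrix.one_mul, conjTranspose_one]
  simp [← mul_assoc, ← Complex.ofReal_mul, Real.mul_self_sqrt hc]

/-- Exchange of the two tensor factors. -/
lemma Separable.of_swap {ρ : Matrix (Fin n × Fin m) (Fin n × Fin m) ℂ}
    (h : Separable (ρ.submatrix Prod.swap Prod.swap)) : Separable ρ := by
  obtain ⟨k, φ, ψ, h⟩ := h
  refine ⟨k, ψ, φ, ?_⟩
  ext x y
  have := congrFun (congrFun h x.swap) y.swap
  simp only [submatrix_apply, Prod.swap_swap, Matrix.sum_apply, vecMulVec_apply, prodVec,
    Pi.star_apply, Prod.fst_swap, Prod.snd_swap] at this ⊢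
  rw [this]
  exact Finset.sum_congr rfl fun t _ => by rw [mul_comm (φ t _), mul_comm (φ t _)]

lemma IsPPT.swap {ρ : Matrix (Fin n × Fin m) (Fin n × Fin m) ℂ} (h : IsPPT ρ) :
    IsPPT (ρ.submatrix Prod.swap Prod.swap) :=
  ⟨h.1.submatrix _, h.2.transpose.submatrix Prod.swap⟩

lemma pt_add (ρ σ : Matrix (Fin n × Fin m) (Fin n × Fin m) ℂ) :
    pt (ρ + σ) = pt ρ + pt σ := rfl

lemma pt_sub (ρ σ : Matrix (Fin n × Fin m) (Fin n × Fin m) ℂ) :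
    pt (ρ - σ) = pt ρ - pt σ := rfl

lemma pt_smul (c : ℂ) (ρ : Matrix (Fin n × Fin m) (Fin n × Fin m) ℂ) :
    pt (c • ρ) = c • pt ρ := rfl

lemma pt_vecMulVec_prodVec (φ : Fin n → ℂ) (ψ : Fin m → ℂ) :
    pt (vecMulVec (prodVec φ ψ) (star (prodVec φ ψ))) =
      vecMulVec (prodVec (star φ) ψ) (star (prodVec (star φ) ψ)) := by
  ext x y
  simp [pt, vecMulVec_apply, prodVec]
  ring

lemma IsPPT.submatrix {ρ : Matrix (Fin n × Fin m) (Fin n × Fin m) ℂ} (h : IsPPT ρ)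
    (f : Fin n' → Fin n) (g : Fin m' → Fin m) :
    IsPPT (ρ.submatrix (Prod.map f g) (Prod.map f g)) :=
  ⟨h.1.submatrix _, h.2.submatrix (Prod.map f g)⟩

end Local

section PosSemidef

variable {ι : Type*} [Fintype ι]

/-- Subtracting from a positive semidefinite `M` its rank-one part `M y yᴴ M / yᴴ M y`. -/
lemma Matrix.PosSemidef.sub_vecMulVec {M : Matrix ι ι ℂ} (hM : M.PosSemidef) (y : ι → ℂ) :
    (M - (star y ⬝ᵥ M *ᵥ y)⁻¹ • vecMulVec (M *ᵥ y) (star (M *ᵥ y))).PosSemidef := by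
  set c := star y ⬝ᵥ M *ᵥ y with hc
  have hc0 : 0 ≤ c := hM.dotProduct_mulVec_nonneg y
  have hcs : star c = c := (IsSelfAdjoint.of_nonneg hc0)
  refine .of_dotProduct_mulVec_nonneg (hM.1.sub ?_) fun x => ?_
  · have hci : star c⁻¹ = c⁻¹ := by rw [star_inv₀, hcs]
    rw [IsHermitian, conjTranspose_smul, conjTranspose_vecMulVec, star_star, hci]
  rcases eq_or_ne c 0 with h0 | h0
  · simpa [h0] using hM.dotProduct_mulVec_nonneg x
  set d := star y ⬝ᵥ M *ᵥ x with hd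
  have hd' : star x ⬝ᵥ M *ᵥ y = star d := by
    rw [hd, dotProduct_mulVec (star y), ← hM.1.eq, ← star_mulVec, star_dotProduct, hM.1.eq,
      dotProduct_comm]
  have hd'' : star (M *ᵥ y) ⬝ᵥ x = d := by
    rw [star_mulVec, hM.1.eq, hd, dotProduct_mulVec]
  have key := hM.dotProduct_mulVec_nonneg (x - (c⁻¹ * d) • y)
  convert key using 1
  simp only [sub_mulVec, smul_mulVec, vecMulVec_mulVec, hd'', dotProduct_sub, mulVec_sub, star_sub,
    sub_dotProduct, mulVec_smul, dotProduct_smul, star_smul, smul_dotProduct, ← hc, ← hd, hd',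
    smul_eq_mul, star_mul', star_inv₀, hcs, MulOpposite.smul_eq_mul_unop, MulOpposite.unop_op]
  field_simp
  ring

lemma Matrix.PosSemidef.mulVec_eq_zero {M : Matrix ι ι ℂ} (hM : M.PosSemidef) {y : ι → ℂ}
    (h : star y ⬝ᵥ M *ᵥ y = 0) : M *ᵥ y = 0 :=
  (hM.dotProduct_mulVec_zero_iff y).1 h

end PosSemidef

section Diagonalization

open Module.End in
lemma LinearMap.IsSymmetric.exists_orthonormalBasis_of_commute {E : Type*} [NormedAddCommGroup E]
    [InnerProductSpace ℂ E] [FiniteDimensional ℂ E] {n : ℕ} (hn : Module.finrank ℂ E = n)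
    {A B : E →ₗ[ℂ] E} (hA : A.IsSymmetric) (hB : B.IsSymmetric) (hAB : Commute A B) :
    ∃ (b : OrthonormalBasis (Fin n) ℂ E) (p : Fin n → ℂ × ℂ),
      ∀ a, A (b a) = (p a).2 • b a ∧ B (b a) = (p a).1 • b a := by
  let f : Eigenvalues B × Eigenvalues A → ℂ × ℂ := fun i => (i.1, i.2)
  have hf : Function.Injective f := by
    rintro ⟨a, b⟩ ⟨c, d⟩ h
    simp only [f, Prod.mk.injEq] at h
    exact Prod.ext (Subtype.ext h.1) (Subtype.ext h.2)
  have hfam := (LinearMap.IsSymmetric.orthogonalFamily_eigenspace_inf_eigenspace hA hB).comp hf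
  have hint : DirectSum.IsInternal (fun i => eigenspace A (f i).2 ⊓ eigenspace B (f i).1) := by
    refine hfam.isInternal_iff.2 ?_
    rw [Submodule.orthogonal_eq_bot_iff, eq_top_iff,
      ← LinearMap.IsSymmetric.iSup_iSup_eigenspace_inf_eigenspace_eq_top_of_commute hA hB hAB]
    refine iSup_le fun α => iSup_le fun β => ?_
    by_cases ha : HasEigenvalue A α
    · by_cases hb : HasEigenvalue B β
      · exact le_iSup (fun i => eigenspace A (f i).2 ⊓ eigenspace B (f i).1)
          (⟨⟨β, hb⟩, ⟨α, ha⟩⟩ : Eigenvalues B × Eigenvalues A)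
      · simp only [hasEigenvalue_iff, not_not] at hb
        rw [hb]; simp
    · simp only [hasEigenvalue_iff, not_not] at ha
      rw [ha]; simp
  refine ⟨hint.subordinateOrthonormalBasis hn hfam,
    fun a => f (hint.subordinateOrthonormalBasisIndex hn a hfam), fun a => ?_⟩
  obtain ⟨h1, h2⟩ := hint.subordinateOrthonormalBasis_subordinate hn a hfam
  exact ⟨mem_eigenspace_iff.1 h1, mem_eigenspace_iff.1 h2⟩

/-- Normal matrices are unitarily diagonalizable. -/
lemma exists_unitary_diagonal {n : ℕ} {N : Matrix (Fin n) (Fin n) ℂ} (hN : N * Nᴴ = Nᴴ * N) :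
    ∃ (U : Matrix (Fin n) (Fin n) ℂ) (d : Fin n → ℂ), Uᴴ * U = 1 ∧ U * Uᴴ = 1 ∧
      N = U * diagonal d * Uᴴ := by
  set H : Matrix (Fin n) (Fin n) ℂ := N + Nᴴ with hH
  set K : Matrix (Fin n) (Fin n) ℂ := Complex.I • (N - Nᴴ) with hK
  have hHs : (toEuclideanLin H).IsSymmetric := isSymmetric_toEuclideanLin_iff.2 (by
    rw [IsHermitian, hH, conjTranspose_add, conjTranspose_conjTranspose, add_comm])
  have hKs : (toEuclideanLin K).IsSymmetric := isSymmetric_toEuclideanLin_iff.2 (by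
    rw [IsHermitian, hK, conjTranspose_smul, conjTranspose_sub, conjTranspose_conjTranspose]
    simp [add_comm, sub_eq_add_neg])
  have hHK : H * K = K * H := by
    rw [hH, hK]
    simp only [Matrix.mul_smul, Matrix.smul_mul, Matrix.add_mul, Matrix.mul_add,
      Matrix.sub_mul, Matrix.mul_sub,
      hN, ← smul_add]
    congr 1
    abel
  have hc : Commute (toEuclideanLin H) (toEuclideanLin K) := by
    refine LinearMap.ext fun v => ?_
    change toEuclideanLin H (toEuclideanLin K v) = toEuclideanLin K (toEuclideanLin H v)
    simp only [toLpLin_apply, mulVec_mulVec, hHK]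
  obtain ⟨b, p, hbp⟩ := LinearMap.IsSymmetric.exists_orthonormalBasis_of_commute
    finrank_euclideanSpace_fin hHs hKs hc
  have hb : ∀ a, ∃ d : ℂ, N *ᵥ (b a).ofLp = d • (b a).ofLp := by
    intro a
    have h1 : H *ᵥ (b a).ofLp = (p a).2 • (b a).ofLp := congrArg WithLp.ofLp (hbp a).1
    have h2 : K *ᵥ (b a).ofLp = (p a).1 • (b a).ofLp := congrArg WithLp.ofLp (hbp a).2
    have hN : N = (1 / 2 : ℂ) • (H - Complex.I • K) := by
      rw [hH, hK, smul_smul, Complex.I_mul_I]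
      ext i j
      simp
      ring
    refine ⟨1 / 2 * ((p a).2 - Complex.I * (p a).1), ?_⟩
    rw [hN, smul_mulVec, sub_mulVec, smul_mulVec, h1, h2]
    ext i
    simp
    ring
  choose d hd using hb
  refine ⟨of fun i a => b a i, d, ?_⟩
  set U : Matrix (Fin n) (Fin n) ℂ := of fun i a => b a i with hU
  have hUU : Uᴴ * U = 1 := by
    ext i j
    have := orthonormal_iff_ite.1 b.orthonormal i j
    rw [EuclideanSpace.inner_eq_star_dotProduct, dotProduct_comm] at this
    simpa [hU, mul_apply, dotProduct, one_apply] using this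
  have hUU' : U * Uᴴ = 1 := mul_eq_one_comm.1 hUU
  refine ⟨hUU, hUU', ?_⟩
  have hNU : N * U = U * diagonal d := by
    ext i a
    have := congrFun (hd a) i
    rw [mul_diagonal, hU, mul_comm]
    simpa [mul_apply, mulVec, dotProduct] using this
  rw [← hNU, Matrix.mul_assoc, hUU', Matrix.mul_one]

end Diagonalization

section Factorization

variable {ι : Type*} [Fintype ι] [DecidableEq ι]

/-- A positive semidefinite matrix of rank `r` factors through `ℂ^r`. -/
lemma Matrix.PosSemidef.exists_factor {M : Matrix ι ι ℂ} (hM : M.PosSemidef) :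
    ∃ (W : Matrix ι (Fin M.rank) ℂ) (W' : Matrix (Fin M.rank) ι ℂ), W' * W = 1 ∧ M = W * Wᴴ := by
  classical
  set ev := hM.1.eigenvalues with hev
  have hnn : ∀ i, 0 ≤ ev i := hM.eigenvalues_nonneg
  obtain ⟨e⟩ : Nonempty (Fin M.rank ≃ {i // ev i ≠ 0}) := by
    rw [← Fintype.card_eq, Fintype.card_fin, hM.1.rank_eq_card_non_zero_eigs]
  set U : Matrix ι ι ℂ := hM.1.eigenvectorUnitary.1 with hU
  have hUU : Uᴴ * U = 1 := Unitary.coe_star_mul_self _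
  have hspec : M = U * diagonal (fun i => (ev i : ℂ)) * Uᴴ := hM.1.spectral_theorem
  refine ⟨of fun i j => U i (e j) * (√(ev (e j)) : ℝ),
    of fun j i => ((√(ev (e j)) : ℝ) : ℂ)⁻¹ * star (U i (e j)), ?_, ?_⟩
  · ext i j
    have h := congrFun (congrFun hUU (e i)) (e j)
    have h0 : (√(ev (e i)) : ℝ) ≠ 0 :=
      Real.sqrt_ne_zero'.2 (lt_of_le_of_ne (hnn _) (Ne.symm (e i).2))
    simp only [mul_apply, conjTranspose_apply, of_apply] at h ⊢
    calc _ = ((√(ev (e i)) : ℝ) : ℂ)⁻¹ * (√(ev (e j)) : ℝ) *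
          ∑ k, star (U k (e i)) * U k (e j) := by
          rw [Finset.mul_sum]
          exact Finset.sum_congr rfl fun _ _ => by ring
      _ = _ := by
          rw [h]
          rcases eq_or_ne i j with rfl | hij
          · simp [h0]
          · rw [one_apply_ne hij, one_apply_ne, mul_zero]
            exact fun h => hij (e.injective (Subtype.ext h))
  · have hs : ∀ k, (√(ev k) : ℂ) * (√(ev k) : ℝ) = ev k := fun k => by
      rw [← Complex.ofReal_mul, Real.mul_self_sqrt (hnn k)]
    ext i j
    conv_lhs => rw [hspec]
    rw [mul_apply, mul_apply]
    simp only [mul_diagonal, conjTranspose_apply, of_apply, star_mul']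
    have : ∀ k : {i // ev i ≠ 0}, U i k * ((√(ev k) : ℝ) : ℂ) *
        (star (U j k) * star ((√(ev k) : ℝ) : ℂ)) = U i k * ev k * star (U j k) := fun k => by
      rw [← hs k]
      simp
      ring
    simp only [this]
    rw [e.sum_comp (fun k : {i // ev i ≠ 0} => U i k * ev k * star (U j k))]
    rw [← Finset.sum_subtype (Finset.univ.filter fun k : ι => ev k ≠ 0) (by simp)
      (fun k => U i k * ev k * star (U j k))]
    refine (Finset.sum_filter_of_ne (p := fun k => ev k ≠ 0) fun k _ h h0 => h ?_).symm
    simp [h0]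

/-- A positive semidefinite matrix of rank at most `k` is a Gram matrix of `k` vectors. -/
lemma Matrix.PosSemidef.exists_factor_of_rank_le {M : Matrix ι ι ℂ} (hM : M.PosSemidef) {k : ℕ}
    (hk : M.rank ≤ k) : ∃ W : Matrix ι (Fin k) ℂ, M = W * Wᴴ := by
  obtain ⟨W, -, -, hW⟩ := hM.exists_factor
  refine ⟨W * (1 : Matrix (Fin k) (Fin k) ℂ).submatrix (Fin.castLE hk) id, ?_⟩
  have : (1 : Matrix (Fin k) (Fin k) ℂ).submatrix (Fin.castLE hk) id *
      ((1 : Matrix (Fin k) (Fin k) ℂ).submatrix (Fin.castLE hk) id)ᴴ = 1 := by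
    rw [conjTranspose_submatrix, conjTranspose_one,]
    ext i j
    simp [mul_apply, one_apply]
  rw [conjTranspose_mul, Matrix.mul_assoc, ← Matrix.mul_assoc _ _ Wᴴ, this, Matrix.one_mul, ← hW]

/-- Every nonzero vector is the `i`-th column of an invertible matrix. -/
lemma exists_basis_change {m : ℕ} {b : Fin m → ℂ} (hb : b ≠ 0) (i : Fin m) :
    ∃ T T' : Matrix (Fin m) (Fin m) ℂ, T' * T = 1 ∧ T * T' = 1 ∧ T *ᵥ Pi.single i 1 = b := by
  obtain ⟨A, hA⟩ := SeparatingDual.exists_continuousLinearEquiv_apply_eq (R := ℂ)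
    (x := (Pi.single i 1 : Fin m → ℂ)) (y := b) (by simp) hb
  have h : LinearMap.toMatrix' (A.symm.toLinearEquiv : (Fin m → ℂ) →ₗ[ℂ] (Fin m → ℂ)) *
      LinearMap.toMatrix' (A.toLinearEquiv : (Fin m → ℂ) →ₗ[ℂ] (Fin m → ℂ)) = 1 := by
    rw [← LinearMap.toMatrix'_comp, ← LinearMap.toMatrix'_id]
    congr 1
    ext1 x
    simp
  refine ⟨_, _, h, mul_eq_one_comm.1 h, ?_⟩
  rw [LinearMap.toMatrix'_mulVec]
  exact hA

end Factorization

section Reduction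

lemma Matrix.PosSemidef.apply_eq_zero_of_diag {ι : Type*} [Fintype ι] [DecidableEq ι]
    {M : Matrix ι ι ℂ} (hM : M.PosSemidef) {a : ι} (h : M a a = 0) (b : ι) :
    M b a = 0 ∧ M a b = 0 := by
  have h1 : M *ᵥ Pi.single a 1 = 0 := hM.mulVec_eq_zero (by simp [h])
  have h2 : M b a = 0 := by simpa using congrFun h1 b
  refine ⟨h2, ?_⟩
  rw [← hM.1.apply, h2, star_zero]

variable {n m m' : ℕ}

/-- A state supported on `ℂ^n ⊗ ℂ^m` for a coordinate subspace `ℂ^m` of `ℂ^m'`. -/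
lemma eq_loc_submatrix {ρ : Matrix (Fin n × Fin m') (Fin n × Fin m') ℂ} {g : Fin m → Fin m'}
    (hg : Function.Injective g)
    (hl : ∀ x y : Fin n × Fin m', x.2 ∉ Set.range g → ρ x y = 0)
    (hr : ∀ x y : Fin n × Fin m', y.2 ∉ Set.range g → ρ x y = 0) :
    ρ = loc 1 ((1 : Matrix (Fin m') (Fin m') ℂ).submatrix id g)
      (ρ.submatrix (Prod.map id g) (Prod.map id g)) := by
  ext ⟨i, j⟩ ⟨k, l⟩
  rw [loc_apply]
  by_cases hj : j ∈ Set.range g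
  · by_cases hk : l ∈ Set.range g
    · obtain ⟨a, rfl⟩ := hj
      obtain ⟨b, rfl⟩ := hk
      simp [Fintype.sum_prod_type, one_apply, hg.eq_iff, apply_ite conj]
    · have : ∀ x, l ≠ g x := fun x h => hk ⟨x, h.symm⟩
      rw [hr _ _ hk]
      simp [one_apply, this]
  · have : ∀ x, j ≠ g x := fun x h => hj ⟨x, h.symm⟩
    rw [hl _ _ hj]
    simp [one_apply, this]

/-- If a PPT state vanishes on all but one of the vectors `e_i ⊗ e_last`, then one can split off
a product vector and lower the dimension of the second factor. -/
lemma IsPPT.separable_of_reduction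
    (IH : ∀ σ : Matrix (Fin n × Fin m) (Fin n × Fin m) ℂ, IsPPT σ → Separable σ)
    {ρ : Matrix (Fin n × Fin (m + 1)) (Fin n × Fin (m + 1)) ℂ} (h : IsPPT ρ) (i₀ : Fin n)
    (h0 : ∀ i ≠ i₀, ρ (i, Fin.last m) (i, Fin.last m) = 0) : Separable ρ := by
  set y : Fin n × Fin (m + 1) → ℂ := Pi.single (i₀, Fin.last m) 1 with hy
  set χ : Fin (m + 1) → ℂ := fun l => ρ (i₀, l) (i₀, Fin.last m) with hχ
  set z := prodVec (Pi.single i₀ 1 : Fin n → ℂ) χ with hz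
  set c := ρ (i₀, Fin.last m) (i₀, Fin.last m) with hc
  have hys : star y = y := by rw [hy, ← Pi.single_star, star_one]
  have hpt : ∀ i ≠ i₀, pt ρ (i, Fin.last m) (i, Fin.last m) = 0 := h0
  have hρy : ρ *ᵥ y = z := by
    ext ⟨k, l⟩
    rcases eq_or_ne k i₀ with rfl | hk
    · simp [hz, hy, hχ, prodVec]
    · have := (h.2.apply_eq_zero_of_diag (hpt k hk) (i₀, l)).1
      simpa [hz, hy, prodVec, hk, pt] using this
  have hρy' : pt ρ *ᵥ y = z := by
    ext ⟨k, l⟩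
    rcases eq_or_ne k i₀ with rfl | hk
    · simp [hz, hy, hχ, prodVec, pt]
    · have := (h.1.apply_eq_zero_of_diag (h0 k hk) (i₀, l)).1
      simpa [hz, hy, prodVec, hk, pt] using this
  have hyz : star y ⬝ᵥ z = c := by simp [hy, hz, hc, hχ, prodVec]
  have hc0 : 0 ≤ c := h.1.diag_nonneg
  set σ := ρ - c⁻¹ • vecMulVec z (star z) with hσ
  have hσP : IsPPT σ := by
    constructor
    · have := h.1.sub_vecMulVec y
      rwa [hρy, hyz] at this
    · have := h.2.sub_vecMulVec y
      rw [hρy', hyz] at this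
      rw [hσ, pt_sub, pt_smul, hz, pt_vecMulVec_prodVec, ← Pi.single_star, star_one]
      exact this
  have hdiag : ∀ i, σ (i, Fin.last m) (i, Fin.last m) = 0 := by
    intro i
    rcases eq_or_ne i i₀ with rfl | hi
    · have hcs : star c = c := IsSelfAdjoint.of_nonneg hc0
      simp only [hσ, hz, Matrix.sub_apply, Matrix.smul_apply, vecMulVec_apply, prodVec, hχ,
        Pi.single_eq_same, one_mul, Pi.star_apply, ← hc,
        hcs, smul_eq_mul]
      rcases eq_or_ne c 0 with h' | h'
      · simp [h']
      · field_simp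
        ring
    · simp [hσ, hz, vecMulVec_apply, prodVec, hi, h0 i hi]
  have hlast : ∀ j : Fin (m + 1), j ∉ Set.range Fin.castSucc → j = Fin.last m := by
    intro j hj
    by_contra hne
    exact hj ⟨j.castPred hne, by simp⟩
  have hs := eq_loc_submatrix (ρ := σ) (Fin.castSucc_injective m)
    (fun ⟨i, j⟩ y hx => by
      obtain rfl := hlast _ hx
      exact (hσP.1.apply_eq_zero_of_diag (hdiag i) y).2)
    (fun y ⟨i, j⟩ hx => by
      obtain rfl := hlast _ hx
      exact (hσP.1.apply_eq_zero_of_diag (hdiag i) y).1)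
  have hsep : Separable σ := by
    rw [hs]
    exact (IH _ (hσP.submatrix id Fin.castSucc)).loc _ _
  have hre : c⁻¹ = ((c.re⁻¹ : ℝ) : ℂ) := by
    rw [Complex.ofReal_inv]
    exact congrArg _ (Complex.ext (by simp) (by simpa using (Complex.le_def.1 hc0).2.symm))
  have : ρ = σ + ((c.re⁻¹ : ℝ) : ℂ) • vecMulVec z (star z) := by
    rw [← hre, hσ, sub_add_cancel]
  rw [this]
  exact hsep.add ((separable_prodVec _ _).smul (inv_nonneg.2 (Complex.le_def.1 hc0).1))

/-- A variant of `IsPPT.separable_of_reduction` in which the distinguished vector of the second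
factor is arbitrary. -/
lemma IsPPT.separable_of_mulVec_eq_zero
    (IH : ∀ σ : Matrix (Fin n × Fin m) (Fin n × Fin m) ℂ, IsPPT σ → Separable σ)
    {ρ : Matrix (Fin n × Fin (m + 1)) (Fin n × Fin (m + 1)) ℂ} (h : IsPPT ρ) (i₀ : Fin n)
    {b : Fin (m + 1) → ℂ} (hb : b ≠ 0)
    (h0 : ∀ i ≠ i₀, ρ *ᵥ prodVec (Pi.single i 1) b = 0) : Separable ρ := by
  obtain ⟨T, T', h1, h2, hT⟩ := exists_basis_change hb (Fin.last m)
  refine Separable.of_loc (S := 1) (T := Tᴴ) 1 T'ᴴ (one_mul _)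
    (by rw [← conjTranspose_mul, h2, conjTranspose_one]) ?_
  refine IsPPT.separable_of_reduction IH (h.loc _ _) i₀ fun i hi => ?_
  have hs : (Pi.single (i, Fin.last m) 1 : Fin n × Fin (m + 1) → ℂ) =
      prodVec (Pi.single i 1) (Pi.single (Fin.last m) 1) := by
    ext ⟨k, l⟩
    simp [prodVec, Pi.single_apply, ← ite_and, and_comm]
  have : _root_.loc 1 Tᴴ ρ *ᵥ Pi.single (i, Fin.last m) 1 = 0 := by
    rw [_root_.loc, hs, ← mulVec_mulVec, conjTranspose_kronecker, conjTranspose_conjTranspose,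
      kronecker_mulVec_prodVec, hT, conjTranspose_one, one_mulVec, ← mulVec_mulVec, h0 i hi,
      mulVec_zero]
  simpa using congrFun this (i, Fin.last m)

end Reduction

section Blocks

variable {n m m' r : ℕ}

/-- The `m × m` blocks of a matrix on `ℂ^n ⊗ ℂ^m`. -/
def block (ρ : Matrix (Fin n × Fin m) (Fin n × Fin m) ℂ) (i k : Fin n) :
    Matrix (Fin m) (Fin m) ℂ :=
  of fun j l => ρ (i, j) (k, l)

lemma ext_block {ρ σ : Matrix (Fin n × Fin m) (Fin n × Fin m) ℂ}
    (h : ∀ i k, block ρ i k = block σ i k) : ρ = σ := by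
  ext ⟨i, j⟩ ⟨k, l⟩
  exact congrFun (congrFun (h i k) j) l

lemma block_pt (ρ : Matrix (Fin n × Fin m) (Fin n × Fin m) ℂ) (i k : Fin n) :
    block (pt ρ) i k = block ρ k i := rfl

lemma block_loc_one (T : Matrix (Fin m') (Fin m) ℂ)
    (ρ : Matrix (Fin n × Fin m) (Fin n × Fin m) ℂ) (i k : Fin n) :
    block (loc 1 T ρ) i k = T * block ρ i k * Tᴴ := by
  ext j l
  simp only [block, of_apply, loc_apply, mul_apply, Fintype.sum_prod_type, Finset.sum_mul]
  simp [one_apply, Finset.sum_ite_irrel, apply_ite conj]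

lemma star_dotProduct_mulVec_eq_sum_block (ρ : Matrix (Fin n × Fin m) (Fin n × Fin m) ℂ)
    (v : Fin n → Fin m → ℂ) :
    star (fun p : Fin n × Fin m => v p.1 p.2) ⬝ᵥ ρ *ᵥ (fun p : Fin n × Fin m => v p.1 p.2) =
      ∑ i, ∑ k, star (v i) ⬝ᵥ block ρ i k *ᵥ v k := by
  simp only [dotProduct, mulVec, Fintype.sum_prod_type, block, of_apply, Finset.mul_sum,
    Pi.star_apply]
  exact Finset.sum_congr rfl fun i _ => Finset.sum_comm

lemma conjTranspose_block {ρ : Matrix (Fin n × Fin m) (Fin n × Fin m) ℂ} (h : ρ.IsHermitian)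
    (i k : Fin n) : (block ρ i k)ᴴ = block ρ k i := by
  ext j l
  simp only [conjTranspose_apply, block, of_apply]
  exact h.apply _ _

/-- A state on `ℂ² ⊗ ℂ^m` built from the compression of a normal matrix is separable. -/
lemma separable_of_normal {N : Matrix (Fin r) (Fin r) ℂ} (hN : N * Nᴴ = Nᴴ * N)
    (V : Matrix (Fin m) (Fin r) ℂ) {ρ : Matrix (Fin 2 × Fin m) (Fin 2 × Fin m) ℂ}
    (h00 : block ρ 0 0 = V * Vᴴ) (h01 : block ρ 0 1 = V * N * Vᴴ)
    (h10 : block ρ 1 0 = V * Nᴴ * Vᴴ) (h11 : block ρ 1 1 = V * (Nᴴ * N) * Vᴴ) :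
    Separable ρ := by
  obtain ⟨U, d, h1, h2, rfl⟩ := exists_unitary_diagonal hN
  set P := V * U with hP
  have e00 : block ρ 0 0 = P * diagonal (fun _ : Fin r => (1 : ℂ)) * Pᴴ := by
    rw [h00, hP, conjTranspose_mul, diagonal_one, Matrix.mul_one, Matrix.mul_assoc V,
      ← Matrix.mul_assoc U, h2, Matrix.one_mul]
  have e01 : block ρ 0 1 = P * diagonal d * Pᴴ := by
    rw [h01, hP, conjTranspose_mul]
    simp only [Matrix.mul_assoc]
  have e10 : block ρ 1 0 = P * diagonal (star d) * Pᴴ := by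
    rw [h10, hP]
    simp only [conjTranspose_mul, conjTranspose_conjTranspose, diagonal_conjTranspose,
      Matrix.mul_assoc]
  have e11 : block ρ 1 1 = P * diagonal (star d * d) * Pᴴ := by
    rw [h11, hP]
    simp only [conjTranspose_mul, conjTranspose_conjTranspose, diagonal_conjTranspose,
      Matrix.mul_assoc]
    rw [← Matrix.mul_assoc Uᴴ U, h1, Matrix.one_mul, ← Matrix.mul_assoc (diagonal (star d)),
      diagonal_mul_diagonal]
    rfl
  refine ⟨r, fun a => ![1, star (d a)], fun a j => P j a, ?_⟩
  ext ⟨i, j⟩ ⟨k, l⟩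
  simp only [Matrix.sum_apply, vecMulVec_apply, prodVec, Pi.star_apply]
  have key : ∀ i k, ρ (i, j) (k, l) = block ρ i k j l := fun _ _ => rfl
  rw [key]
  fin_cases i <;> fin_cases k <;>
    simp only [Fin.zero_eta, Fin.mk_one, e00, e01, e10, e11] <;>
    rw [mul_apply] <;> refine Finset.sum_congr rfl fun a _ => ?_ <;>
    simp [mul_diagonal, -mul_eq_mul_left_iff, -mul_eq_mul_right_iff] <;> ring

/-- The Schur complement of the identity block. -/
lemma Matrix.PosSemidef.schur_succ {M : Matrix (Fin (n + 1) × Fin m) (Fin (n + 1) × Fin m) ℂ}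
    (h : M.PosSemidef) (h00 : block M 0 0 = 1) :
    (of fun x y : Fin n × Fin m => (block M x.1.succ y.1.succ -
      block M x.1.succ 0 * block M 0 y.1.succ) x.2 y.2 : Matrix _ _ ℂ).PosSemidef := by
  set f : Fin m ⊕ Fin n × Fin m → Fin (n + 1) × Fin m :=
    Sum.elim (fun j => (0, j)) (fun x => (x.1.succ, x.2)) with hf
  have h1 := h.submatrix f
  set K : Matrix (Fin m) (Fin n × Fin m) ℂ := of fun j y => M (0, j) (y.1.succ, y.2) with hK
  set L : Matrix (Fin n × Fin m) (Fin n × Fin m) ℂ :=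
    of fun x y => M (x.1.succ, x.2) (y.1.succ, y.2) with hL
  have e : M.submatrix f f = fromBlocks 1 K Kᴴ L := by
    rw [← h00]
    ext (j | x) (l | y)
    · rfl
    · rfl
    · exact (h.1.apply _ _).symm
    · rfl
  let _ : Invertible (1 : Matrix (Fin m) (Fin m) ℂ) := invertibleOne
  rw [e, PosDef.one.fromBlocks₁₁, inv_one, Matrix.mul_one] at h1
  refine (congrArg PosSemidef ?_).mp h1
  ext x y
  simp only [hK, hL, block, of_apply, Matrix.sub_apply, mul_apply, conjTranspose_apply, h.1.apply]

lemma Matrix.PosSemidef.schur {ρ : Matrix (Fin 2 × Fin m) (Fin 2 × Fin m) ℂ} (h : ρ.PosSemidef)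
    (h00 : block ρ 0 0 = 1) :
    (block ρ 1 1 - block ρ 1 0 * block ρ 0 1).PosSemidef :=
  (h.schur_succ h00).submatrix fun j => ((0 : Fin 1), j)

end Blocks

section Dilation

lemma exists_unimodular_mul_eq {a b : ℂ} (h : a * conj a = b * conj b) :
    ∃ w : ℂ, w * conj w = 1 ∧ a = w * b := by
  rcases eq_or_ne b 0 with rfl | hb
  · exact ⟨1, by simp, by simpa using h⟩
  · have hb' : conj b ≠ 0 := by simpa using hb
    refine ⟨a / b, ?_, by field_simp⟩
    rw [map_div₀]
    field_simp
    exact h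

lemma mul_conj_eq_of_mul_eq {a b c e : ℂ} (h1 : a * b = c * e)
    (h2 : a * conj a + c * conj c = b * conj b + e * conj e) (h3 : conj b * e = a * conj c) :
    a * conj a = e * conj e ∧ b * conj b = c * conj c := by
  have h1' := congrArg conj h1
  have h3' := congrArg conj h3
  simp only [map_mul, Complex.conj_conj] at h1' h3'
  have key : (a * conj a - e * conj e) * (b * conj b + c * conj c) = 0 := by
    linear_combination conj a * conj b * h1 + c * e * h1' - b * conj e * h3 - a * conj c * h3'
  rcases mul_eq_zero.1 key with h | h
  · exact ⟨by linear_combination h, by linear_combination h - h2⟩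
  · simp only [Complex.mul_conj] at h
    norm_cast at h
    have hb : b = 0 := Complex.normSq_eq_zero.1
      (by linarith [Complex.normSq_nonneg b, Complex.normSq_nonneg c])
    have hc : c = 0 := Complex.normSq_eq_zero.1
      (by linarith [Complex.normSq_nonneg b, Complex.normSq_nonneg c])
    subst hb hc
    exact ⟨by linear_combination h2, rfl⟩

lemma exists_normal_dilation {B : Matrix (Fin 3) (Fin 3) ℂ} {p q : ℂ}
    (hpq : p * conj p - q * conj q ≠ 0)
    (hD : Bᴴ * B + vecMulVec ![conj q, 0, conj p] (star ![conj q, 0, conj p]) =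
      B * Bᴴ + vecMulVec ![p, 0, q] (star ![p, 0, q])) :
    ∃ (N : Matrix (Fin 4) (Fin 4) ℂ) (V : Matrix (Fin 3) (Fin 4) ℂ), N * Nᴴ = Nᴴ * N ∧
      V * Vᴴ = 1 ∧ V * N * Vᴴ = B ∧
      V * (Nᴴ * N) * Vᴴ = Bᴴ * B + vecMulVec ![conj q, 0, conj p] (star ![conj q, 0, conj p]) := by
  have h := fun i j => congrFun (congrFun hD i) j
  simp only [Matrix.add_apply, mul_apply, Fin.sum_univ_three, conjTranspose_apply, vecMulVec_apply,
    Pi.star_apply] at h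
  have h00 := h 0 0
  have h01 := h 0 1
  have h02 := h 0 2
  have h10 := h 1 0
  have h11 := h 1 1
  have h12 := h 1 2
  have h20 := h 2 0
  have h21 := h 2 1
  have h22 := h 2 2
  simp only [cons_val_zero, cons_val_one, cons_val, RCLike.star_def, Complex.conj_conj, map_zero,
    mul_zero, zero_mul, add_zero] at h00 h01 h02 h10 h11 h12 h20 h21 h22
  clear h
  have e1 : B 0 0 = B 2 2 := by
    refine mul_left_cancel₀ hpq ?_
    linear_combination - h00 * B 0 0 - h01 * B 1 0 - h02 * B 2 0 - h10 * B 0 1 - h11 * B 1 1 -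
      h12 * B 2 1 - h20 * B 0 2 - h21 * B 1 2 - h22 * B 2 2
  have e2 : B 0 1 * B 1 0 = B 2 1 * B 1 2 := by
    refine mul_left_cancel₀ hpq ?_
    linear_combination - h00 * (B 0 0 * B 0 0 + B 0 1 * B 1 0 + B 0 2 * B 2 0) - h01 * (B 1 0 *
      B 0 0 + B 1 1 * B 1 0 + B 1 2 * B 2 0) - h02 * (B 2 0 * B 0 0 + B 2 1 * B 1 0 + B 2 2 * B
      2 0) - h10 * (B 0 0 * B 0 1 + B 0 1 * B 1 1 + B 0 2 * B 2 1) - h11 * (B 1 0 * B 0 1 + B 1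
      1 * B 1 1 + B 1 2 * B 2 1) - h12 * (B 2 0 * B 0 1 + B 2 1 * B 1 1 + B 2 2 * B 2 1) - h20 *
      (B 0 0 * B 0 2 + B 0 1 * B 1 2 + B 0 2 * B 2 2) - h21 * (B 1 0 * B 0 2 + B 1 1 * B 1 2 + B
      1 2 * B 2 2) - h22 * (B 2 0 * B 0 2 + B 2 1 * B 1 2 + B 2 2 * B 2 2) - (p * conj p - q *
      conj q) * (B 0 0 + B 2 2) * e1
  have e3 : conj (B 1 0) * B 1 2 = B 0 1 * conj (B 2 1) := by
    have e1' := congrArg conj e1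
    linear_combination h02 - B 0 2 * e1' + conj (B 2 0) * e1
  obtain ⟨e4, e5⟩ := mul_conj_eq_of_mul_eq e2 (by linear_combination h11) e3
  have e3' : B 1 0 * conj (B 1 2) = conj (B 0 1) * B 2 1 := by simpa using congrArg conj e3
  obtain ⟨w, hw, hwB⟩ := exists_unimodular_mul_eq
    (a := B 1 0 * conj q + B 1 2 * conj p) (b := conj (B 0 1) * p + conj (B 2 1) * q) (by
      simp only [map_add, map_mul, Complex.conj_conj]
      linear_combination q * conj q * e5 - p * conj p * e4 + conj q * p * e3' + conj p * q * e3)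
  set Δ := p * conj p - q * conj q with hΔ
  set z := (B 2 0 * p * conj q - B 0 2 * conj p * q + w * conj (B 2 0) * q ^ 2 -
    w * conj (B 0 2) * p ^ 2) / Δ with hz
  have hz1 : z * Δ = B 2 0 * p * conj q - B 0 2 * conj p * q + w * conj (B 2 0) * q ^ 2 -
    w * conj (B 0 2) * p ^ 2 := div_mul_cancel₀ _ hpq
  have hΔc : conj Δ = Δ := by simp [hΔ, mul_comm]
  have hz2 : w * conj z * Δ = w * conj (B 2 0) * conj p * q - w * conj (B 0 2) * p * conj q +
      B 2 0 * conj q ^ 2 - B 0 2 * conj p ^ 2 := by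
    have h := congrArg conj hz1
    simp only [map_mul, map_add, map_sub, map_pow, Complex.conj_conj, hΔc] at h
    linear_combination w * h + (B 2 0 * conj q ^ 2 - B 0 2 * conj p ^ 2) * hw
  have z0 : B 0 2 * conj p + w * conj z * p = w * conj (B 2 0) * q + z * conj q := by
    refine mul_left_cancel₀ hpq ?_
    linear_combination p * hz2 - conj q * hz1 + (B 0 2 * conj p - w * conj (B 2 0) * q) * hΔ
  have z2 : B 2 0 * conj q + w * conj z * q = w * conj (B 0 2) * p + z * conj p := by
    refine mul_left_cancel₀ hpq ?_
    linear_combination q * hz2 - conj p * hz1 + (B 2 0 * conj q - w * conj (B 0 2) * p) * hΔ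
  set ζ := B 0 0 + z with hζ
  have hζc : conj ζ = conj (B 0 0) + conj z := by rw [hζ, map_add]
  have c0 : B 0 0 * conj q + B 0 2 * conj p + w * p * conj ζ =
      conj (B 0 0) * (w * p) + conj (B 2 0) * (w * q) + conj q * ζ := by
    linear_combination z0 + w * p * hζc - conj q * hζ
  have c1 : B 1 0 * conj q + B 1 2 * conj p = conj (B 0 1) * (w * p) + conj (B 2 1) * (w * q) := by
    linear_combination hwB
  have c2 : B 2 0 * conj q + B 2 2 * conj p + w * q * conj ζ =
      conj (B 0 2) * (w * p) + conj (B 2 2) * (w * q) + conj p * ζ := by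
    have e1' := congrArg conj e1
    linear_combination z2 + w * q * hζc - conj p * hζ - conj p * e1 + w * q * e1'
  have d0 := congrArg conj c0
  have d1 := congrArg conj c1
  have d2 := congrArg conj c2
  simp only [map_mul, map_add, Complex.conj_conj] at d0 d1 d2
  have hww : ∀ a b, w * a * (conj w * conj b) = a * conj b := fun a b => by
    linear_combination a * conj b * hw
  refine ⟨!![B 0 0, B 0 1, B 0 2, w * p; B 1 0, B 1 1, B 1 2, 0; B 2 0, B 2 1, B 2 2, w * q;
    q, 0, p, ζ], !![1, 0, 0, 0; 0, 1, 0, 0; 0, 0, 1, 0], ?_, ?_, ?_, ?_⟩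
  · clear_value ζ z Δ
    ext i j
    fin_cases i <;> fin_cases j <;>
      simp only [mul_apply, Fin.sum_univ_four, conjTranspose_apply, of_apply, cons_val,
        RCLike.star_def, Fin.zero_eta, Fin.mk_one, Fin.reduceFinMk, cons_val_zero, cons_val_one,
        map_mul, map_zero, mul_zero, zero_mul, add_zero, hww]
    · linear_combination -h00
    · linear_combination -h01
    · linear_combination -h02
    · linear_combination c0
    · linear_combination -h10
    · linear_combination -h11
    · linear_combination -h12
    · linear_combination c1
    · linear_combination -h20
    · linear_combination -h21
    · linear_combination -h22
    · linear_combination c2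
    · linear_combination d0
    · linear_combination d1
    · linear_combination d2
    · linear_combination -(p * conj p + q * conj q) * hw
  · ext i j
    fin_cases i <;> fin_cases j <;> simp [mul_apply, Fin.sum_univ_four]
  · ext i j
    fin_cases i <;> fin_cases j <;> simp [mul_apply, Fin.sum_univ_four]
  · ext i j
    fin_cases i <;> fin_cases j <;>
      simp only [mul_apply, Matrix.add_apply, Fin.sum_univ_four, Fin.sum_univ_three,
        vecMulVec_apply, conjTranspose_apply, of_apply, cons_val, RCLike.star_def, Fin.zero_eta,
        Fin.mk_one, Fin.reduceFinMk, cons_val_zero, cons_val_one, map_one, map_zero, Pi.star_apply,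
        Complex.conj_conj] <;>
      ring

end Dilation

section RankOneDefect

lemma separable_of_diagonal_defect {B : Matrix (Fin 3) (Fin 3) ℂ} {x y : Fin 3 → ℂ}
    (hD : Bᴴ * B + vecMulVec y (star y) = B * Bᴴ + vecMulVec x (star x)) {d : ℂ} (hd : d ≠ 0)
    (hB : Bᴴ * B - B * Bᴴ = diagonal ![d, 0, -d])
    {ρ : Matrix (Fin 2 × Fin 3) (Fin 2 × Fin 3) ℂ} (h00 : block ρ 0 0 = 1)
    (h01 : block ρ 0 1 = B) (h10 : block ρ 1 0 = Bᴴ)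
    (h11 : block ρ 1 1 = Bᴴ * B + vecMulVec y (star y)) : Separable ρ := by
  have h : ∀ i j, x i * conj (x j) - y i * conj (y j) = (diagonal ![d, 0, -d]) i j := by
    intro i j
    rw [← hB]
    have := congrFun (congrFun hD i) j
    simp only [Matrix.add_apply, vecMulVec_apply, Pi.star_apply, RCLike.star_def] at this
    rw [Matrix.sub_apply]
    linear_combination -this
  have h00' := h 0 0
  have h01' := h 0 1
  have h02' := h 0 2
  have h11' := h 1 1
  have h12' := h 1 2
  have h22' := h 2 2
  simp [diagonal] at h00' h01' h02' h11' h12' h22'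
  have hx1 : x 1 * conj (x 1) = 0 := by
    have e : d * (x 1 * conj (x 1)) = 0 := by
      have h01c := congrArg conj h01'
      simp only [map_mul, map_sub, map_zero, Complex.conj_conj] at h01c
      linear_combination - x 1 * conj (x 1) * h00' + conj (x 0) * x 1 * h01' +
        y 0 * conj (y 1) * h01c - y 0 * conj (y 0) * h11'
    exact (mul_eq_zero.1 e).resolve_left hd
  have hy1 : y 1 * conj (y 1) = 0 := by linear_combination hx1 - h11'
  have hx1 : x 1 = 0 := by simpa using hx1
  have hy1 : y 1 = 0 := by simpa using hy1
  have e1 : y 2 * conj (y 2) = x 0 * conj (x 0) := by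
    have e : d * (y 2 * conj (y 2) - x 0 * conj (x 0)) = 0 := by
      have h02c := congrArg conj h02'
      simp only [map_mul, map_sub, map_zero, Complex.conj_conj] at h02c
      linear_combination - x 0 * conj (x 0) * h22' + conj (x 0) * x 2 * h02' +
        y 0 * conj (y 2) * h02c - y 2 * conj (y 2) * h00'
    exact sub_eq_zero.1 ((mul_eq_zero.1 e).resolve_left hd)
  have e2 : y 0 * conj (y 0) = x 2 * conj (x 2) := by linear_combination - h00' - h22' - e1
  have hx : x = ![x 0, 0, x 2] := by
    ext i; fin_cases i <;> simp [hx1]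
  have hyy : vecMulVec y (star y) =
      vecMulVec ![conj (x 2), 0, conj (x 0)] (star ![conj (x 2), 0, conj (x 0)]) := by
    have h02c := congrArg conj h02'
    simp only [map_mul, map_sub, map_zero, Complex.conj_conj] at h02c
    ext i j
    fin_cases i <;> fin_cases j <;> simp [vecMulVec_apply, hy1, -mul_eq_mul_left_iff,
      -mul_eq_mul_right_iff]
    · linear_combination e2
    · linear_combination - h02'
    · linear_combination - h02c
    · linear_combination e1
  rw [hyy] at hD h11
  rw [hx] at hD
  obtain ⟨N, V, hN, hV, hVN, hVV⟩ := exists_normal_dilation (p := x 0) (q := x 2)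
    (by intro h0; apply hd; linear_combination h0 - h00' - e2) hD
  refine separable_of_normal hN V (h00.trans hV.symm) (h01.trans hVN.symm) ?_ (h11.trans hVV.symm)
  rw [h10, ← hVN]
  simp [Matrix.mul_assoc]

lemma separable_of_rank_one_defect {B : Matrix (Fin 3) (Fin 3) ℂ} {x y : Fin 3 → ℂ}
    (hD : Bᴴ * B + vecMulVec y (star y) = B * Bᴴ + vecMulVec x (star x))
    {ρ : Matrix (Fin 2 × Fin 3) (Fin 2 × Fin 3) ℂ} (h00 : block ρ 0 0 = 1)
    (h01 : block ρ 0 1 = B) (h10 : block ρ 1 0 = Bᴴ)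
    (h11 : block ρ 1 1 = Bᴴ * B + vecMulVec y (star y)) : Separable ρ := by
  set D := Bᴴ * B - B * Bᴴ with hDdef
  have hDH : Dᴴ = D := by simp [hDdef]
  have hDxy : D = vecMulVec x (star x) - vecMulVec y (star y) := by
    rw [hDdef, sub_eq_sub_iff_add_eq_add, hD, add_comm]
  have htr : D.trace = 0 := by rw [hDdef, trace_sub, trace_mul_comm, sub_self]
  have hdet : D.det = 0 := by
    rw [hDxy, det_fin_three]
    simp only [Matrix.sub_apply, vecMulVec_apply]
    ring
  obtain ⟨U, d, h1, h2, hU⟩ := exists_unitary_diagonal (N := D) (by rw [hDH])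
  have hdU : D.det = d 0 * d 1 * d 2 := by
    rw [hU, det_mul, det_mul, mul_right_comm, ← det_mul, h2, det_one, one_mul, det_diagonal,
      Fin.prod_univ_three]
  have htU : D.trace = d 0 + d 1 + d 2 := by
    rw [hU, trace_mul_comm, ← Matrix.mul_assoc, h1, Matrix.one_mul, trace_diagonal,
      Fin.sum_univ_three]
  rw [htr] at htU
  rw [hdet] at hdU
  obtain ⟨σ, hσ⟩ : ∃ σ : Equiv.Perm (Fin 3), d (σ 1) = 0 := by
    rcases mul_eq_zero.1 hdU.symm with h | h
    · rcases mul_eq_zero.1 h with h | h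
      · exact ⟨Equiv.swap 0 1, by simpa using h⟩
      · exact ⟨1, by simpa using h⟩
    · exact ⟨Equiv.swap 1 2, by simpa using h⟩
  have hσ2 : d (σ 2) = - d (σ 0) := by
    have e : ∑ i, d (σ i) = 0 := by
      rw [Equiv.sum_comp σ d, Fin.sum_univ_three, ← htU]
    rw [Fin.sum_univ_three, hσ] at e
    linear_combination e
  have hdσ : d ∘ σ = ![d (σ 0), 0, - d (σ 0)] := by
    ext i; fin_cases i <;> simp [hσ, hσ2]
  rcases eq_or_ne (d (σ 0)) 0 with h0 | h0
  · have hd0 : d = 0 := by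
      have e : d ∘ σ = 0 := by rw [hdσ, h0]; ext i; fin_cases i <;> simp
      ext i
      simpa using congrFun e (σ.symm i)
    have hBN : B * Bᴴ = Bᴴ * B := by
      have : D = 0 := by rw [hU, hd0]; simp
      rw [hDdef, sub_eq_zero] at this
      exact this.symm
    set ρ₁ := ρ - vecMulVec (prodVec (Pi.single 1 1) y) (star (prodVec (Pi.single 1 1) y)) with hρ₁
    have hb : ∀ i k, block ρ₁ i k = block ρ i k -
        ((Pi.single 1 1 : Fin 2 → ℂ) i * (Pi.single 1 1 : Fin 2 → ℂ) k) •
          vecMulVec y (star y) := by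
      intro i k
      ext j l
      simp only [hρ₁, block, vecMulVec_apply, prodVec, of_apply, Matrix.sub_apply,
        Matrix.smul_apply, Pi.star_apply, smul_eq_mul, StarMul.star_mul]
      have : star ((Pi.single 1 1 : Fin 2 → ℂ) k) = (Pi.single 1 1 : Fin 2 → ℂ) k := by
        fin_cases k <;> simp
      rw [this]
      ring
    have hs : Separable ρ₁ := by
      refine separable_of_normal hBN 1 ?_ ?_ ?_ ?_ <;> rw [hb] <;> simp [h00, h01, h10, h11]
    have := hs.add (separable_prodVec (Pi.single 1 1) y)
    rwa [hρ₁, sub_add_cancel] at this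
  · set P := U.submatrix id σ with hP
    have hP1 : Pᴴ * P = 1 := by
      rw [hP, conjTranspose_submatrix, ← submatrix_mul _ _ _ _ _ Function.bijective_id, h1,
        submatrix_one_equiv]
    have hP2 : P * Pᴴ = 1 := mul_eq_one_comm.1 hP1
    have hPD : Pᴴ * D * P = diagonal ![d (σ 0), 0, - d (σ 0)] := by
      have e : Uᴴ * D * U = diagonal d := by
        rw [hU]
        simp only [Matrix.mul_assoc, h1, Matrix.mul_one]
        rw [← Matrix.mul_assoc, h1, Matrix.one_mul]
      rw [← hdσ, ← submatrix_diagonal_equiv, ← e, hP, conjTranspose_submatrix]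
      rfl
    have cancel : ∀ X Y : Matrix (Fin 3) (Fin 3) ℂ,
        Pᴴ * (X * Y) * P = Pᴴ * X * P * (Pᴴ * Y * P) := by
      intro X Y
      simp only [Matrix.mul_assoc]
      rw [← Matrix.mul_assoc P, hP2, Matrix.one_mul]
    have hv : ∀ z : Fin 3 → ℂ, Pᴴ * vecMulVec z (star z) * P =
        vecMulVec (Pᴴ *ᵥ z) (star (Pᴴ *ᵥ z)) := by
      intro z
      rw [mul_vecMulVec, vecMulVec_mul, star_mulVec, conjTranspose_conjTranspose]
    have hBP : (Pᴴ * B * P)ᴴ = Pᴴ * Bᴴ * P := by simp [Matrix.mul_assoc]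
    refine Separable.of_loc 1 P (S := 1) (T := Pᴴ) (Matrix.one_mul 1) hP2 ?_
    refine separable_of_diagonal_defect (B := Pᴴ * B * P) (x := Pᴴ *ᵥ x) (y := Pᴴ *ᵥ y) ?_ h0 ?_
      ?_ ?_ ?_ ?_
    · rw [hBP, ← cancel, ← cancel, ← hv, ← hv, ← Matrix.add_mul, ← Matrix.add_mul,
        ← Matrix.mul_add, ← Matrix.mul_add, hD]
    · rw [hBP, ← cancel, ← cancel, ← Matrix.sub_mul, ← Matrix.mul_sub, ← hPD]
    all_goals rw [block_loc_one, conjTranspose_conjTranspose]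
    · rw [h00, Matrix.mul_one, hP1]
    · rw [h01]
    · rw [h10, hBP]
    · rw [h11, hBP, Matrix.mul_add, Matrix.add_mul, cancel, hv]

end RankOneDefect

section RankReduction

lemma Matrix.rank_lt_card_of_mulVec_eq_zero {ι κ : Type*} [Fintype ι] [Fintype κ]
    {M : Matrix ι κ ℂ} {v : κ → ℂ} (hv : v ≠ 0) (h : M *ᵥ v = 0) : M.rank < Fintype.card κ := by
  have h1 := M.mulVecLin.finrank_range_add_finrank_ker
  have : Nontrivial M.mulVecLin.ker :=
    ⟨⟨⟨v, by simpa using h⟩, 0, fun e => hv (congrArg Subtype.val e)⟩⟩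
  have h2 : 0 < Module.finrank ℂ M.mulVecLin.ker := Module.finrank_pos
  rw [Module.finrank_fintype_fun_eq_card] at h1
  rw [Matrix.rank]
  omega

lemma Matrix.IsHermitian.exists_boundary {ι : Type*} [Fintype ι] [DecidableEq ι]
    {Z : Matrix ι ι ℂ} (hZ : Z.IsHermitian) (hn : ¬ Z.PosSemidef) :
    ∃ t : ℝ, 0 < t ∧ (1 + (t : ℂ) • Z).PosSemidef ∧ ∃ v, v ≠ 0 ∧ (1 + (t : ℂ) • Z) *ᵥ v = 0 := by
  rw [hZ.posSemidef_iff_eigenvalues_nonneg, Pi.le_def] at hn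
  push Not at hn
  obtain ⟨j, hj⟩ := hn
  have : Nonempty ι := ⟨j⟩
  obtain ⟨i, hi⟩ := Finite.exists_min hZ.eigenvalues
  have hμ : hZ.eigenvalues i < 0 := (hi j).trans_lt (by simpa using hj)
  set μ := hZ.eigenvalues i with hμdef
  refine ⟨-μ⁻¹, by simpa using hμ, ?_, hZ.eigenvectorBasis i, ?_, ?_⟩
  · set U := hZ.eigenvectorUnitary.1
    have h1 : U * Uᴴ = 1 := Unitary.coe_mul_star_self _
    have e : 1 + ((-μ⁻¹ : ℝ) : ℂ) • Z =
        U * diagonal (fun k => ((1 - μ⁻¹ * hZ.eigenvalues k : ℝ) : ℂ)) * Uᴴ := by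
      have hs : Z = U * diagonal (fun k => (hZ.eigenvalues k : ℂ)) * Uᴴ := hZ.spectral_theorem
      have hd : diagonal (fun k => ((1 - μ⁻¹ * hZ.eigenvalues k : ℝ) : ℂ)) =
          1 + ((-μ⁻¹ : ℝ) : ℂ) • diagonal (fun k => (hZ.eigenvalues k : ℂ)) := by
        ext a b
        by_cases hab : a = b
        · subst hab; simp; ring
        · simp [hab]
      rw [hd, Matrix.mul_add, Matrix.add_mul, Matrix.mul_one, h1, Matrix.mul_smul,
        Matrix.smul_mul, ← hs]
    rw [e]
    refine (PosSemidef.diagonal fun k => ?_).mul_mul_conjTranspose_same U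
    have : 0 ≤ 1 - μ⁻¹ * hZ.eigenvalues k := by
      have h2 : μ⁻¹ * hZ.eigenvalues k ≤ μ⁻¹ * μ :=
        mul_le_mul_of_nonpos_left (hi k) (inv_nonpos.2 hμ.le)
      rw [inv_mul_cancel₀ hμ.ne] at h2
      linarith
    exact Complex.zero_le_real.2 this
  · intro h0
    have := hZ.eigenvectorBasis.orthonormal.ne_zero i
    exact this (by ext k; exact congrFun h0 k)
  · have := hZ.mulVec_eigenvectorBasis i
    rw [add_mulVec, one_mulVec, smul_mulVec, this, ← hμdef]
    ext k
    have hμ' : (μ : ℂ) ≠ 0 := by exact_mod_cast hμ.ne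
    simp
    field_simp
    simp

lemma exists_boundary_pair {p q : ℕ} {X : Matrix (Fin p) (Fin p) ℂ} {Y : Matrix (Fin q) (Fin q) ℂ}
    (hX : X.IsHermitian) (hY : Y.IsHermitian) (hX0 : X ≠ 0) (htr : X.trace = 0) :
    ∃ t : ℝ, 0 < t ∧ (1 + (t : ℂ) • X).PosSemidef ∧ (1 + (t : ℂ) • Y).PosSemidef ∧
      (1 + (t : ℂ) • X).rank + (1 + (t : ℂ) • Y).rank < p + q := by
  have hZ : (fromBlocks X 0 0 Y).IsHermitian := hX.fromBlocks (by simp) hY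
  have e (t : ℂ) : 1 + t • fromBlocks X 0 0 Y = fromBlocks (1 + t • X) 0 0 (1 + t • Y) := by
    rw [← fromBlocks_one, fromBlocks_smul, fromBlocks_add]
    simp
  obtain ⟨t, ht, h1, v, hv, hv0⟩ := hZ.exists_boundary fun h => by
    have h' : X.PosSemidef := h.submatrix Sum.inl
    exact hX0 (h'.trace_eq_zero_iff.1 htr)
  rw [e] at h1 hv0
  refine ⟨t, ht, h1.submatrix Sum.inl, h1.submatrix Sum.inr, ?_⟩
  have r1 := (1 + (t : ℂ) • X).rank_le_card_width
  have r2 := (1 + (t : ℂ) • Y).rank_le_card_width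
  simp only [Fintype.card_fin] at r1 r2
  rw [fromBlocks_mulVec] at hv0
  have hl : (1 + (t : ℂ) • X) *ᵥ (v ∘ Sum.inl) = 0 := by
    ext i; simpa using congrFun hv0 (Sum.inl i)
  have hr : (1 + (t : ℂ) • Y) *ᵥ (v ∘ Sum.inr) = 0 := by
    ext i; simpa using congrFun hv0 (Sum.inr i)
  by_cases h : v ∘ Sum.inl = 0
  · have h' : v ∘ Sum.inr ≠ 0 := fun h' => hv (by
      ext i; rcases i with i | i
      · exact congrFun h i
      · exact congrFun h' i)
    have := rank_lt_card_of_mulVec_eq_zero h' hr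
    simp only [Fintype.card_fin] at this
    omega
  · have := rank_lt_card_of_mulVec_eq_zero h hl
    simp only [Fintype.card_fin] at this
    omega

end RankReduction

section Extremal

variable {n m : ℕ}

lemma exists_hermitian_pair {p q : ℕ} {W : Matrix (Fin n × Fin m) (Fin p) ℂ}
    {V : Matrix (Fin n × Fin m) (Fin q) ℂ} {V' : Matrix (Fin q) (Fin n × Fin m) ℂ}
    (hV : V' * V = 1) (hpq : (n * m) ^ 2 + 1 < p ^ 2 + q ^ 2) :
    ∃ (X : Matrix (Fin p) (Fin p) ℂ) (Y : Matrix (Fin q) (Fin q) ℂ), X.IsHermitian ∧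
      Y.IsHermitian ∧ X ≠ 0 ∧ X.trace = 0 ∧ pt (W * X * Wᴴ) = V * Y * Vᴴ := by
  let f : Matrix (Fin p) (Fin p) ℂ × Matrix (Fin q) (Fin q) ℂ →ₗ[ℂ]
      Matrix (Fin n × Fin m) (Fin n × Fin m) ℂ × ℂ :=
    { toFun := fun Z => (pt (W * Z.1 * Wᴴ) - V * Z.2 * Vᴴ, Z.1.trace)
      map_add' := fun Z Z' => by
        simp only [Prod.fst_add, Prod.snd_add, Matrix.mul_add, Matrix.add_mul, pt_add, trace_add,
          Prod.mk_add_mk, Prod.mk.injEq, and_true]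
        abel
      map_smul' := fun c Z => by
        simp only [Prod.smul_fst, Prod.smul_snd, Matrix.mul_smul, Matrix.smul_mul, pt_smul,
          trace_smul, RingHom.id_apply, Prod.smul_mk, smul_sub] }
  have hf : LinearMap.ker f ≠ ⊥ := by
    refine LinearMap.ker_ne_bot_of_finrank_lt ?_
    simp only [Module.finrank_prod, Module.finrank_matrix, Fintype.card_fin, Fintype.card_prod,
      Module.finrank_self, mul_one]
    nlinarith
  obtain ⟨⟨X, Y⟩, hXY, hne⟩ := Submodule.exists_mem_ne_zero_of_ne_bot hf
  have hk : ∀ {X Y}, (X, Y) ∈ LinearMap.ker f ↔ pt (W * X * Wᴴ) = V * Y * Vᴴ ∧ X.trace = 0 := by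
    intro X Y
    rw [LinearMap.mem_ker]
    change (_, _) = (0 : _ × _) ↔ _
    rw [Prod.mk_eq_zero, sub_eq_zero]
  have hXY' : (Xᴴ, Yᴴ) ∈ LinearMap.ker f := by
    obtain ⟨h1, h2⟩ := hk.1 hXY
    refine hk.2 ⟨?_, by rw [trace_conjTranspose, h2, star_zero]⟩
    have := congrArg conjTranspose h1
    simp only [conjTranspose_mul, conjTranspose_conjTranspose, ← Matrix.mul_assoc] at this
    rw [← this]
    have e : W * Xᴴ * Wᴴ = (W * X * Wᴴ)ᴴ := by simp [Matrix.mul_assoc]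
    rw [e]
    rfl
  have hX0 : ∀ {X Y}, (X, Y) ∈ LinearMap.ker f → (X, Y) ≠ 0 → X ≠ 0 := by
    rintro X Y h h0 rfl
    obtain ⟨h1, -⟩ := hk.1 h
    refine h0 (Prod.mk_eq_zero.2 ⟨rfl, ?_⟩)
    have hV2 : Vᴴ * V'ᴴ = 1 := by rw [← conjTranspose_mul, hV, conjTranspose_one]
    have h2 : V * Y * Vᴴ = 0 := by rw [← h1, Matrix.mul_zero, Matrix.zero_mul]; rfl
    have e : V' * (V * Y * Vᴴ) * V'ᴴ = 0 := by rw [h2, Matrix.mul_zero, Matrix.zero_mul]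
    rwa [Matrix.mul_assoc V, ← Matrix.mul_assoc V', hV, Matrix.one_mul, Matrix.mul_assoc, hV2,
      Matrix.mul_one] at e
  by_cases h0 : (X, Y) + (Xᴴ, Yᴴ) = 0
  · have hX : Xᴴ = -X := by
      rw [Prod.mk_add_mk, Prod.mk_eq_zero] at h0
      exact eq_neg_of_add_eq_zero_right h0.1
    have hY : Yᴴ = -Y := by
      rw [Prod.mk_add_mk, Prod.mk_eq_zero] at h0
      exact eq_neg_of_add_eq_zero_right h0.2
    have hm := (LinearMap.ker f).smul_mem Complex.I hXY
    refine ⟨Complex.I • X, Complex.I • Y, ?_, ?_, hX0 hm (smul_ne_zero Complex.I_ne_zero hne),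
      (hk.1 hm).2, (hk.1 hm).1⟩
    · simp [IsHermitian, hX]
    · simp [IsHermitian, hY]
  · have hm := (LinearMap.ker f).add_mem hXY hXY'
    exact ⟨X + Xᴴ, Y + Yᴴ, isHermitian_add_transpose_self X, isHermitian_add_transpose_self Y,
      hX0 hm h0, (hk.1 hm).2, (hk.1 hm).1⟩

lemma IsPPT.exists_smaller_rank {ρ : Matrix (Fin n × Fin m) (Fin n × Fin m) ℂ} (h : IsPPT ρ)
    (hpq : (n * m) ^ 2 + 1 < ρ.rank ^ 2 + (pt ρ).rank ^ 2) :
    ∃ (σ τ : Matrix (Fin n × Fin m) (Fin n × Fin m) ℂ) (a b : ℝ), IsPPT σ ∧ IsPPT τ ∧ 0 ≤ a ∧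
      0 ≤ b ∧ ρ = (a : ℂ) • σ + (b : ℂ) • τ ∧ σ.rank + (pt σ).rank < ρ.rank + (pt ρ).rank ∧
      τ.rank + (pt τ).rank < ρ.rank + (pt ρ).rank := by
  obtain ⟨W, -, -, hW⟩ := h.1.exists_factor
  obtain ⟨V, V', hV', hV⟩ := h.2.exists_factor
  obtain ⟨X, Y, hX, hY, hX0, htr, hXY⟩ := exists_hermitian_pair (W := W) hV' hpq
  have key : ∀ {X : Matrix (Fin ρ.rank) (Fin ρ.rank) ℂ}
      {Y : Matrix (Fin (pt ρ).rank) (Fin (pt ρ).rank) ℂ}, X.IsHermitian → Y.IsHermitian → X ≠ 0 →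
      X.trace = 0 → pt (W * X * Wᴴ) = V * Y * Vᴴ → ∃ t : ℝ, 0 < t ∧
        IsPPT (ρ + (t : ℂ) • (W * X * Wᴴ)) ∧ (ρ + (t : ℂ) • (W * X * Wᴴ)).rank +
          (pt (ρ + (t : ℂ) • (W * X * Wᴴ))).rank < ρ.rank + (pt ρ).rank := by
    intro X Y hX hY hX0 htr hXY
    obtain ⟨t, ht, h1, h2, h3⟩ := exists_boundary_pair hX hY hX0 htr
    have e1 : ρ + (t : ℂ) • (W * X * Wᴴ) = W * (1 + (t : ℂ) • X) * Wᴴ := by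
      rw [Matrix.mul_add, Matrix.add_mul, Matrix.mul_one, ← hW, Matrix.mul_smul, Matrix.smul_mul]
    have e2 : pt (ρ + (t : ℂ) • (W * X * Wᴴ)) = V * (1 + (t : ℂ) • Y) * Vᴴ := by
      rw [pt_add, pt_smul, hXY, Matrix.mul_add, Matrix.add_mul, Matrix.mul_one, ← hV,
        Matrix.mul_smul, Matrix.smul_mul]
    refine ⟨t, ht, ⟨?_, ?_⟩, ?_⟩
    · rw [e1]; exact h1.mul_mul_conjTranspose_same W
    · rw [e2]; exact h2.mul_mul_conjTranspose_same V
    · rw [e2, e1]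
      refine lt_of_le_of_lt (add_le_add ?_ ?_) h3 <;>
        exact (rank_mul_le_left _ _).trans (rank_mul_le_right _ _)
  obtain ⟨s, hs, hs1, hs2⟩ := key hX hY hX0 htr hXY
  obtain ⟨t, ht, ht1, ht2⟩ := key hX.neg hY.neg (neg_ne_zero.2 hX0)
    (by rw [trace_neg, htr, neg_zero])
    (by rw [Matrix.mul_neg, Matrix.neg_mul, Matrix.mul_neg, Matrix.neg_mul, ← hXY]; rfl)
  refine ⟨_, _, t / (s + t), s / (s + t), hs1, ht1, by positivity, by positivity, ?_, hs2, ht2⟩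
  have hst : (s : ℂ) + t ≠ 0 := by exact_mod_cast (add_pos hs ht).ne'
  rw [Matrix.mul_neg, Matrix.neg_mul]
  ext i j
  simp only [Matrix.add_apply, Matrix.smul_apply, Matrix.neg_apply, smul_eq_mul]
  push_cast
  field_simp
  ring

/-- Separability of all PPT states follows from that of those of small rank. -/
lemma separable_of_forall_small_rank
    (H : ∀ ρ : Matrix (Fin n × Fin m) (Fin n × Fin m) ℂ, IsPPT ρ →
      ρ.rank ^ 2 + (pt ρ).rank ^ 2 ≤ (n * m) ^ 2 + 1 → Separable ρ)
    {ρ : Matrix (Fin n × Fin m) (Fin n × Fin m) ℂ} (h : IsPPT ρ) : Separable ρ := by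
  induction hk : ρ.rank + (pt ρ).rank using Nat.strong_induction_on generalizing ρ with
  | _ k IH =>
    by_cases hs : ρ.rank ^ 2 + (pt ρ).rank ^ 2 ≤ (n * m) ^ 2 + 1
    · exact H ρ h hs
    · obtain ⟨σ, τ, a, b, hσ, hτ, ha, hb, rfl, h1, h2⟩ := h.exists_smaller_rank (not_le.1 hs)
      exact ((IH _ (hk ▸ h1) hσ rfl).smul ha).add ((IH _ (hk ▸ h2) hτ rfl).smul hb)

end Extremal

section QubitQutrit

lemma Matrix.PosSemidef.rank_schur_add_le {m : ℕ} {ρ : Matrix (Fin 2 × Fin m) (Fin 2 × Fin m) ℂ}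
    (h : ρ.PosSemidef) (h00 : block ρ 0 0 = 1) :
    (block ρ 1 1 - block ρ 1 0 * block ρ 0 1).rank + m ≤ ρ.rank := by
  obtain ⟨W, -, -, hW⟩ := h.exists_factor
  set R : Fin 2 → Matrix (Fin m) (Fin ρ.rank) ℂ := fun i => of fun j a => W (i, j) a with hR
  have hb : ∀ i k, block ρ i k = R i * (R k)ᴴ := by
    intro i k
    ext j l
    simp only [block, of_apply]
    conv_lhs => rw [hW]
    simp [hR, mul_apply]
  have h1 : R 0 * (R 0)ᴴ = 1 := by rw [← hb, h00]
  have hP : (1 - (R 0)ᴴ * R 0) * (R 0)ᴴ = 0 := by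
    rw [Matrix.sub_mul, Matrix.one_mul, Matrix.mul_assoc, h1, Matrix.mul_one, sub_self]
  have hE : block ρ 1 1 - block ρ 1 0 * block ρ 0 1 = R 1 * (1 - (R 0)ᴴ * R 0) * (R 1)ᴴ := by
    rw [hb, hb, hb, Matrix.mul_sub, Matrix.sub_mul, Matrix.mul_one]
    simp only [Matrix.mul_assoc]
  have h2 := rank_add_rank_le_card_of_mul_eq_zero hP
  have h3 : m ≤ (R 0)ᴴ.rank := by
    have := rank_mul_le_right (R 0) (R 0)ᴴ
    rwa [h1, rank_one, Fintype.card_fin] at this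
  have h4 := (rank_mul_le_left (R 1 * (1 - (R 0)ᴴ * R 0)) (R 1)ᴴ).trans
    (rank_mul_le_right (R 1) (1 - (R 0)ᴴ * R 0))
  rw [hE]
  simp only [Fintype.card_fin] at h2
  omega

lemma Matrix.PosSemidef.one_le_rank {m : ℕ} {E : Matrix (Fin m) (Fin m) ℂ}
    (hE : E.PosSemidef) (h0 : E ≠ 0) : 1 ≤ E.rank := by
  by_contra! hr
  obtain ⟨W, rfl⟩ := hE.exists_factor_of_rank_le (k := 0) (by omega)
  exact h0 (by ext; simp [mul_apply])

lemma Matrix.PosSemidef.exists_vecMulVec {m : ℕ} {E : Matrix (Fin m) (Fin m) ℂ}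
    (hE : E.PosSemidef) (hr : E.rank ≤ 1) : ∃ y, E = vecMulVec y (star y) := by
  obtain ⟨W, rfl⟩ := hE.exists_factor_of_rank_le hr
  exact ⟨fun j => W j 0, by ext; simp [mul_apply, vecMulVec_apply]⟩

lemma IsPPT.separable_of_block_eq_one {m : ℕ} (hm : m ≤ 3)
    {ρ : Matrix (Fin 2 × Fin m) (Fin 2 × Fin m) ℂ} (h : IsPPT ρ)
    (hr : ρ.rank ^ 2 + (pt ρ).rank ^ 2 ≤ (2 * m) ^ 2 + 1) (h00 : block ρ 0 0 = 1) :
    Separable ρ := by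
  have h00' : block (pt ρ) 0 0 = 1 := h00
  have hE := h.1.schur h00
  have hF := h.2.schur h00'
  have rE := h.1.rank_schur_add_le h00
  have rF := h.2.rank_schur_add_le h00'
  simp only [block_pt] at hF rF
  rw [← conjTranspose_block h.1.1 0 1] at hE hF rE rF
  set B := block ρ 0 1 with hB
  set C := block ρ 1 1 with hC
  have h10 : block ρ 1 0 = Bᴴ := (conjTranspose_block h.1.1 0 1).symm
  have htr : (C - Bᴴ * B).trace = (C - B * Bᴴ).trace := by
    rw [trace_sub, trace_sub, trace_mul_comm]
  have hEF : C - Bᴴ * B = 0 → C - B * Bᴴ = 0 → Separable ρ := by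
    intro h1 h2
    rw [sub_eq_zero] at h1 h2
    refine separable_of_normal (h2.symm.trans h1) 1 ?_ ?_ ?_ ?_
    · simpa using h00
    · simpa using hB.symm
    · simpa using h10
    · simpa using h1
  by_cases hE0 : C - Bᴴ * B = 0
  · exact hEF hE0 (hF.trace_eq_zero_iff.1 (by rw [← htr, hE0, trace_zero]))
  by_cases hF0 : C - B * Bᴴ = 0
  · exact hEF (hE.trace_eq_zero_iff.1 (by rw [htr, hF0, trace_zero])) hF0
  have pE : 1 ≤ (C - Bᴴ * B).rank := hE.one_le_rank hE0
  have pF : 1 ≤ (C - B * Bᴴ).rank := hF.one_le_rank hF0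
  have hm3 : m = 3 := by
    interval_cases m <;> nlinarith
  subst hm3
  obtain ⟨y, hy⟩ := hE.exists_vecMulVec (by nlinarith)
  obtain ⟨x, hx⟩ := hF.exists_vecMulVec (by nlinarith)
  have h11 : C = Bᴴ * B + vecMulVec y (star y) := by rw [← hy]; abel
  refine separable_of_rank_one_defect (x := x) ?_ h00 rfl h10 h11
  rw [← h11, ← hx]; abel

/-- The Peres–Horodecki criterion in dimensions `2 × m` for `m ≤ 3`. -/
theorem IsPPT.separable_two {m : ℕ} (hm : m ≤ 3) {ρ : Matrix (Fin 2 × Fin m) (Fin 2 × Fin m) ℂ}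
    (h : IsPPT ρ) : Separable ρ := by
  induction m with
  | zero => exact ⟨0, fun _ => 0, fun _ => 0, by ext ⟨_, j⟩; exact j.elim0⟩
  | succ k IH =>
    refine separable_of_forall_small_rank (fun ρ h hr => ?_) h
    have hA : (block ρ 0 0).PosSemidef := h.1.submatrix (fun j => ((0 : Fin 2), j))
    by_cases hp : (block ρ 0 0).PosDef
    · obtain ⟨W, hW⟩ := hA.exists_factor_of_rank_le (k := k + 1)
        (by simpa using (block ρ 0 0).rank_le_card_width)
      have hWd : IsUnit W.det := by
        have h1 := (isUnit_iff_isUnit_det _).1 hp.isUnit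
        rw [hW, det_mul] at h1
        exact isUnit_of_mul_isUnit_left h1
      refine Separable.of_loc 1 W (S := 1) (T := W⁻¹) (Matrix.one_mul 1) (mul_nonsing_inv _ hWd) ?_
      refine (h.loc 1 W⁻¹).separable_of_block_eq_one hm (le_trans (add_le_add ?_ ?_) hr) ?_
      · exact Nat.pow_le_pow_left ((rank_mul_le_left _ _).trans (rank_mul_le_right _ _)) 2
      · rw [pt_loc]
        exact Nat.pow_le_pow_left ((rank_mul_le_left _ _).trans (rank_mul_le_right _ _)) 2
      · rw [block_loc_one, hW, ← Matrix.mul_assoc, nonsing_inv_mul _ hWd, Matrix.one_mul,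
          ← conjTranspose_mul, nonsing_inv_mul _ hWd, conjTranspose_one]
    · obtain ⟨b, hb, hb0⟩ : ∃ b, b ≠ 0 ∧ block ρ 0 0 *ᵥ b = 0 := by
        by_contra! hcon
        refine hp (PosDef.of_dotProduct_mulVec_pos hA.1 fun {x} hx => ?_)
        refine lt_of_le_of_ne (hA.dotProduct_mulVec_nonneg x) fun h0 => hcon x hx ?_
        exact (hA.dotProduct_mulVec_zero_iff x).1 h0.symm
      refine h.separable_of_mulVec_eq_zero (fun σ hσ => IH (by omega) hσ) 1 hb fun i hi => ?_
      obtain rfl : i = 0 := by omega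
      rw [← h.1.dotProduct_mulVec_zero_iff]
      have := star_dotProduct_mulVec_eq_sum_block ρ
        (fun i j => (Pi.single 0 1 : Fin 2 → ℂ) i * b j)
      have e0 : (fun j => (Pi.single 0 1 : Fin 2 → ℂ) 0 * b j) = b := by simp
      have e1 : (fun j => (Pi.single 0 1 : Fin 2 → ℂ) 1 * b j) = 0 := by ext; simp
      refine Eq.trans this ?_
      simp only [Fin.sum_univ_two, e0, e1, hb0]
      simp

theorem IsPPT.separable_three_two {ρ : Matrix (Fin 3 × Fin 2) (Fin 3 × Fin 2) ℂ} (h : IsPPT ρ) :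
    Separable ρ :=
  Separable.of_swap (h.swap.separable_two le_rfl)

end QubitQutrit

section Gram

variable {n m n' m' r : ℕ}

/-- The Gram-type state with blocks `D i * (D k)ᴴ`. -/
def blockGram (D : Fin n → Matrix (Fin m) (Fin r) ℂ) : Matrix (Fin n × Fin m) (Fin n × Fin m) ℂ :=
  of fun x y => (D x.1 * (D y.1)ᴴ) x.2 y.2

lemma blockGram_eq (D : Fin n → Matrix (Fin m) (Fin r) ℂ) :
    blockGram D = (of fun x a => D x.1 x.2 a : Matrix (Fin n × Fin m) (Fin r) ℂ) *
      (of fun x a => D x.1 x.2 a : Matrix (Fin n × Fin m) (Fin r) ℂ)ᴴ := by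
  ext x y
  simp [blockGram, mul_apply]

lemma posSemidef_blockGram (D : Fin n → Matrix (Fin m) (Fin r) ℂ) : (blockGram D).PosSemidef := by
  rw [blockGram_eq]
  exact posSemidef_self_mul_conjTranspose _

lemma block_blockGram (D : Fin n → Matrix (Fin m) (Fin r) ℂ) (i k : Fin n) :
    block (blockGram D) i k = D i * (D k)ᴴ := rfl

lemma loc_blockGram (S : Matrix (Fin n') (Fin n) ℂ) (T : Matrix (Fin m') (Fin m) ℂ)
    (D : Fin n → Matrix (Fin m) (Fin r) ℂ) :
    loc S T (blockGram D) = blockGram fun i => T * ∑ k, S i k • D k := by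
  rw [blockGram_eq, blockGram_eq, loc, ← Matrix.mul_assoc, Matrix.mul_assoc _ _ (S ⊗ₖ T)ᴴ,
    ← conjTranspose_mul]
  congr 2 <;>
  · ext x a
    simp only [mul_apply, kroneckerMap_apply, Fintype.sum_prod_type, of_apply, Matrix.sum_apply,
      Matrix.smul_apply, smul_eq_mul, Finset.mul_sum]
    rw [Finset.sum_comm]
    exact Finset.sum_congr rfl fun _ _ => Finset.sum_congr rfl fun _ _ => by ring

lemma blockGram_mul_right (D : Fin n → Matrix (Fin m) (Fin r) ℂ) {U : Matrix (Fin r) (Fin r) ℂ}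
    (hU : U * Uᴴ = 1) : blockGram (fun i => D i * U) = blockGram D := by
  refine ext_block fun i k => ?_
  rw [block_blockGram, block_blockGram, conjTranspose_mul, Matrix.mul_assoc,
    ← Matrix.mul_assoc U, hU, Matrix.one_mul]

lemma Matrix.IsHermitian.pt {ρ : Matrix (Fin n × Fin m) (Fin n × Fin m) ℂ} (h : ρ.IsHermitian) :
    (pt ρ).IsHermitian := by
  ext x y
  exact h.apply _ _

/-- Splitting off an index that is reduced by every block. -/
lemma blockGram_eq_add (D : Fin n → Matrix (Fin (m + 1)) (Fin (m + 1)) ℂ) (l : Fin (m + 1))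
    (h : ∀ i, ∀ j ≠ l, D i j l = 0 ∧ D i l j = 0) :
    blockGram D = vecMulVec (prodVec (fun i => D i l l) (Pi.single l 1))
        (star (prodVec (fun i => D i l l) (Pi.single l 1))) +
      loc 1 ((1 : Matrix (Fin (m + 1)) (Fin (m + 1)) ℂ).submatrix id l.succAbove)
        (blockGram fun i => (D i).submatrix l.succAbove l.succAbove) := by
  rw [loc_blockGram]
  ext ⟨i, j⟩ ⟨k, j'⟩
  simp only [blockGram, of_apply, Matrix.add_apply, vecMulVec_apply, Pi.star_apply, prodVec,
    one_apply, ite_smul, one_smul, zero_smul, Finset.sum_ite_eq, Finset.mem_univ, if_true]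
  have hz : ∀ j, (1 : Matrix (Fin (m + 1)) (Fin (m + 1)) ℂ).submatrix id l.succAbove l j = 0 := by
    intro j
    simp [one_apply, (Fin.succAbove_ne l j).symm]
  have hs : ∀ (j : Fin m) (a : Fin m) (i : Fin n),
      ((1 : Matrix (Fin (m + 1)) (Fin (m + 1)) ℂ).submatrix id l.succAbove *
        (D i).submatrix l.succAbove l.succAbove) (l.succAbove j) a =
      D i (l.succAbove j) (l.succAbove a) := by
    intro j a i
    simp [mul_apply, one_apply]
  have hl : ∀ (a : Fin m) (i : Fin n),
      ((1 : Matrix (Fin (m + 1)) (Fin (m + 1)) ℂ).submatrix id l.succAbove *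
        (D i).submatrix l.succAbove l.succAbove) l a = 0 := by
    intro a i
    rw [mul_apply]
    simp only [hz, zero_mul, Finset.sum_const_zero]
  rw [mul_apply, mul_apply, Fin.sum_univ_succAbove _ l]
  simp only [conjTranspose_apply]
  have hne : ∀ j, l.succAbove j ≠ l := Fin.succAbove_ne l
  rcases Fin.eq_self_or_eq_succAbove l j with hj | ⟨j, rfl⟩ <;>
    rcases Fin.eq_self_or_eq_succAbove l j' with hj' | ⟨j', rfl⟩
  · simp only [hj, hj', hl]
    simp [(h _ _ (hne _)).2]
  · simp only [hj, hl]
    simp [(h _ _ (hne _)).1, (h _ _ (hne _)).2]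
  · simp only [hj', hl]
    simp [(h _ _ (hne _)).1, (h _ _ (hne _)).2]
  · simp only [hs]
    simp [(h _ _ (hne _)).1]

end Gram

section Reduced

variable {n m : ℕ}

lemma star_prodVec (φ : Fin n → ℂ) (ψ : Fin m → ℂ) :
    star (prodVec φ ψ) = prodVec (star φ) (star ψ) := by
  ext x
  simp [prodVec]

lemma prodVec_dotProduct_prodVec (φ φ' : Fin n → ℂ) (ψ ψ' : Fin m → ℂ) :
    prodVec φ ψ ⬝ᵥ prodVec φ' ψ' = (φ ⬝ᵥ φ') * (ψ ⬝ᵥ ψ') := by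
  simp only [dotProduct, prodVec, Fintype.sum_mul_sum, Fintype.sum_prod_type]
  exact Finset.sum_congr rfl fun _ _ => Finset.sum_congr rfl fun _ _ => by ring

lemma IsPPT.separable_of_reduced {D : Fin 3 → Matrix (Fin 3) (Fin 3) ℂ} {ψ : Fin 3 → ℂ}
    (h : IsPPT (blockGram D +
      vecMulVec (prodVec (Pi.single 2 1 : Fin 3 → ℂ) ψ) (star (prodVec (Pi.single 2 1) ψ))))
    (h0 : D 0 = 1) (l : Fin 3) (hl : ∀ i, ∀ j ≠ l, D i j l = 0 ∧ D i l j = 0) :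
    Separable (blockGram D +
      vecMulVec (prodVec (Pi.single 2 1 : Fin 3 → ℂ) ψ) (star (prodVec (Pi.single 2 1) ψ))) := by
  have hg := blockGram_eq_add D l hl
  set J := (1 : Matrix (Fin 3) (Fin 3) ℂ).submatrix id l.succAbove with hJ
  set τ := blockGram fun i => (D i).submatrix l.succAbove l.succAbove with hτ
  set f : Fin 3 → ℂ := fun i => D i l l with hf
  have hf0 : f 0 = 1 := by simp [hf, h0]
  by_cases hψ : ψ l = 0
  · have hJψ : ψ = J *ᵥ (ψ ∘ l.succAbove) := by
      ext j
      rcases Fin.eq_self_or_eq_succAbove l j with hj | ⟨j, rfl⟩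
      · rw [hj, hψ]
        simp [hJ, mulVec, dotProduct, one_apply, (Fin.succAbove_ne l _).symm]
      · simp [hJ, mulVec, dotProduct, one_apply]
    have hz : vecMulVec (prodVec (Pi.single 2 1 : Fin 3 → ℂ) ψ)
        (star (prodVec (Pi.single 2 1) ψ)) =
        _root_.loc 1 J (vecMulVec (prodVec (Pi.single 2 1 : Fin 3 → ℂ) (ψ ∘ l.succAbove))
          (star (prodVec (Pi.single 2 1) (ψ ∘ l.succAbove)))) := by
      rw [loc_vecMulVec, kronecker_mulVec_prodVec, ← hJψ, one_mulVec]
    have hs : τ + vecMulVec (prodVec (Pi.single 2 1) (ψ ∘ l.succAbove))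
          (star (prodVec (Pi.single 2 1) (ψ ∘ l.succAbove))) =
        (blockGram D + vecMulVec (prodVec (Pi.single 2 1 : Fin 3 → ℂ) ψ)
          (star (prodVec (Pi.single 2 1) ψ))).submatrix (Prod.map id l.succAbove)
            (Prod.map id l.succAbove) := by
      ext ⟨i, j⟩ ⟨k, j'⟩
      simp only [hτ, blockGram, of_apply, Matrix.add_apply, submatrix_apply, Prod.map, id,
        mul_apply, conjTranspose_apply, Fin.sum_univ_succAbove _ l,
        (hl _ _ (Fin.succAbove_ne l _)).1, zero_mul, zero_add]
      rfl
    rw [hg, hz, add_assoc, ← loc_add, hs]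
    exact (separable_prodVec _ _).add (((h.submatrix id l.succAbove).separable_three_two).loc _ _)
  · have hJJ : Jᴴ * J = 1 := by
      rw [hJ, conjTranspose_submatrix, conjTranspose_one, ← submatrix_mul _ _ _ _ _
        Function.bijective_id, Matrix.one_mul, submatrix_one _ Fin.succAbove_right_injective]
    have hJl : Jᴴ *ᵥ Pi.single l 1 = 0 := by
      ext j
      simp [hJ, one_apply, Fin.succAbove_ne l j]
    have hK : ((1 : Matrix (Fin 3) (Fin 3) ℂ) ⊗ₖ J)ᴴ = 1 ⊗ₖ Jᴴ := by
      rw [conjTranspose_kronecker, conjTranspose_one]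
    have hKl : ∀ φ : Fin 3 → ℂ, ((1 : Matrix (Fin 3) (Fin 3) ℂ) ⊗ₖ J)ᴴ *ᵥ
        prodVec φ (Pi.single l 1) = 0 := by
      intro φ
      rw [hK, kronecker_mulVec_prodVec, hJl]
      ext; simp [prodVec]
    have hKK : ((1 : Matrix (Fin 3) (Fin 3) ℂ) ⊗ₖ J)ᴴ * ((1 : Matrix (Fin 3) (Fin 3) ℂ) ⊗ₖ J) =
        1 := by
      rw [hK, ← mul_kronecker_mul, hJJ, Matrix.one_mul, one_kronecker_one]
    set K := (1 : Matrix (Fin 3) (Fin 3) ℂ) ⊗ₖ J with hKdef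
    set a := prodVec (star f) (Pi.single l 1 : Fin 3 → ℂ) with ha
    set b := prodVec (star (Pi.single 2 1 : Fin 3 → ℂ)) ψ with hb
    have hpt : pt (blockGram D + vecMulVec (prodVec (Pi.single 2 1 : Fin 3 → ℂ) ψ)
        (star (prodVec (Pi.single 2 1) ψ))) =
        vecMulVec a (star a) + K * pt τ * Kᴴ + vecMulVec b (star b) := by
      rw [hg, pt_add, pt_add, pt_vecMulVec_prodVec, pt_vecMulVec_prodVec, pt_loc, _root_.loc,
        Matrix.map_one _ (star_zero _) (star_one _)]
    have hτP : IsPPT τ := by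
      refine ⟨posSemidef_blockGram _, .of_dotProduct_mulVec_nonneg (posSemidef_blockGram _).1.pt
        fun w => ?_⟩
      set c₂ := -(star b ⬝ᵥ K *ᵥ w) / star (ψ l) with hc₂
      set v := K *ᵥ w + (-(c₂ * f 2)) • prodVec (Pi.single 0 1 : Fin 3 → ℂ) (Pi.single l 1) +
        c₂ • prodVec (Pi.single 2 1 : Fin 3 → ℂ) (Pi.single l 1) with hv
      have hKv : Kᴴ *ᵥ v = w := by
        rw [hv, mulVec_add, mulVec_add, mulVec_smul, mulVec_smul, hKl, hKl, mulVec_mulVec, hKK]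
        simp
      have hvK : star v ᵥ* K = star w := by
        rw [← hKv, star_mulVec, conjTranspose_conjTranspose]
      have hav : star a ⬝ᵥ v = 0 := by
        have h1 : star a ⬝ᵥ K *ᵥ w = 0 := by
          rw [dotProduct_mulVec, ← conjTranspose_conjTranspose K, ← star_mulVec, ha, hKl]
          simp
        rw [hv, dotProduct_add, dotProduct_add, h1, dotProduct_smul, dotProduct_smul, ha,
          star_prodVec, prodVec_dotProduct_prodVec, prodVec_dotProduct_prodVec]
        simp [hf0]
      have hbv : star b ⬝ᵥ v = 0 := by
        have h2 : star (ψ l) ≠ 0 := by simpa using hψ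
        have h3 : c₂ * star (ψ l) = -(star b ⬝ᵥ K *ᵥ w) := div_mul_cancel₀ _ h2
        have h4 : star b ⬝ᵥ prodVec (Pi.single 0 1 : Fin 3 → ℂ) (Pi.single l 1) = 0 := by
          rw [hb, star_prodVec, prodVec_dotProduct_prodVec]
          simp
        have h5 : star b ⬝ᵥ prodVec (Pi.single 2 1 : Fin 3 → ℂ) (Pi.single l 1) = star (ψ l) := by
          rw [hb, star_prodVec, prodVec_dotProduct_prodVec]
          simp
        rw [hv, dotProduct_add, dotProduct_add, dotProduct_smul, dotProduct_smul, h4, h5]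
        simp only [smul_eq_mul]
        linear_combination h3
      have := h.2.dotProduct_mulVec_nonneg v
      rw [hpt, add_mulVec, add_mulVec, vecMulVec_mulVec, vecMulVec_mulVec, hav, hbv] at this
      rw [← mulVec_mulVec, hKv, ← mulVec_mulVec, dotProduct_add, dotProduct_add,
        dotProduct_mulVec _ K, hvK] at this
      simpa using this
    rw [hg]
    exact ((separable_prodVec _ _).add (hτP.separable_three_two.loc _ _)).add
      (separable_prodVec _ _)

end Reduced

section Invertible

variable {D : Fin 3 → Matrix (Fin 3) (Fin 3) ℂ} {ψ : Fin 3 → ℂ}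

lemma IsPPT.separable_of_diagonal
    (h : IsPPT (blockGram D +
      vecMulVec (prodVec (Pi.single 2 1 : Fin 3 → ℂ) ψ) (star (prodVec (Pi.single 2 1) ψ))))
    (h0 : D 0 = 1) {d : Fin 3 → ℂ} (h1 : D 1 = diagonal d)
    (h2 : ∀ j l, d j ≠ d l → D 2 j l = 0) :
    Separable (blockGram D +
      vecMulVec (prodVec (Pi.single 2 1 : Fin 3 → ℂ) ψ) (star (prodVec (Pi.single 2 1) ψ))) := by
  by_cases hd : ∃ l, ∀ j ≠ l, d j ≠ d l
  · obtain ⟨l, hl⟩ := hd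
    refine h.separable_of_reduced h0 l fun i j hj => ?_
    fin_cases i
    · simp [h0, one_apply, hj, hj.symm]
    · simp [h1, hj, hj.symm]
    · exact ⟨h2 _ _ (hl j hj), h2 _ _ (hl j hj).symm⟩
  · have hc : ∀ j, d j = d 0 := by
      simp only [Fin.exists_fin_succ, Fin.forall_fin_succ] at hd ⊢
      simp at hd ⊢
      grind
    have hD1 : D 1 = d 0 • 1 := by
      rw [h1, smul_one_eq_diagonal]
      exact congrArg diagonal (funext hc)
    have hs := (h.submatrix ![0, 2] id).separable_two le_rfl
    have hS : blockGram D +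
      vecMulVec (prodVec (Pi.single 2 1 : Fin 3 → ℂ) ψ) (star (prodVec (Pi.single 2 1) ψ)) =
        _root_.loc !![1, 0; d 0, 0; 0, 1] 1 ((blockGram D +
          vecMulVec (prodVec (Pi.single 2 1 : Fin 3 → ℂ) ψ)
            (star (prodVec (Pi.single 2 1) ψ))).submatrix (Prod.map ![0, 2] id)
              (Prod.map ![0, 2] id)) := by
      have hs' : (blockGram D +
          vecMulVec (prodVec (Pi.single 2 1 : Fin 3 → ℂ) ψ)
            (star (prodVec (Pi.single 2 1) ψ))).submatrix (Prod.map ![0, 2] id)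
              (Prod.map ![0, 2] id) = blockGram (fun i => D (![0, 2] i)) +
          vecMulVec (prodVec (Pi.single 1 1 : Fin 2 → ℂ) ψ)
            (star (prodVec (Pi.single 1 1) ψ)) := by
        have he : ∀ i : Fin 2, (Pi.single 2 1 : Fin 3 → ℂ) (![0, 2] i) =
            (Pi.single 1 1 : Fin 2 → ℂ) i := by
          intro i
          fin_cases i <;> simp
        ext ⟨i, j⟩ ⟨k, l⟩
        simp [blockGram, vecMulVec_apply, prodVec, he]
      rw [hs', loc_add, loc_blockGram, loc_vecMulVec, kronecker_mulVec_prodVec, one_mulVec]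
      congr 3
      · funext i
        fin_cases i
        · simp
        · simp [h0, hD1]
        · simp
      all_goals
        congr 1
        ext i
        fin_cases i <;> simp [mulVec, dotProduct]
    rw [hS]
    exact hs.loc _ _

lemma IsPPT.separable_of_apply_zero_eq_one
    (h : IsPPT (blockGram D +
      vecMulVec (prodVec (Pi.single 2 1 : Fin 3 → ℂ) ψ) (star (prodVec (Pi.single 2 1) ψ))))
    (h0 : D 0 = 1) :
    Separable (blockGram D +
      vecMulVec (prodVec (Pi.single 2 1 : Fin 3 → ℂ) ψ) (star (prodVec (Pi.single 2 1) ψ))) := by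
  have hb : ∀ i k, (i = 2 → k ≠ 2) → block (blockGram D +
      vecMulVec (prodVec (Pi.single 2 1 : Fin 3 → ℂ) ψ) (star (prodVec (Pi.single 2 1) ψ))) i k =
      D i * (D k)ᴴ := by
    intro i k hik
    rw [← block_blockGram]
    ext j l
    by_cases hi : i = 2
    · simp [block, vecMulVec_apply, prodVec, hik hi]
    · simp [block, vecMulVec_apply, prodVec, hi]
  have hQ := h.2.schur_succ (by rw [block_pt, hb 0 0 (by decide), h0]; simp)
  simp only [block_pt] at hQ
  set Q : Matrix (Fin 2 × Fin 3) (Fin 2 × Fin 3) ℂ := of fun x y => _ with hQdef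
  have hQ0 : ∀ k j l, Q (0, j) (k, l) = (D k.succ * (D 1)ᴴ - (D 1)ᴴ * D k.succ) j l := by
    intro k j l
    have e1 := hb k.succ 1 (fun _ => by decide)
    have e2 := hb 0 1 (by decide)
    have e3 := hb k.succ 0 (fun _ => by decide)
    simp only [hQdef, of_apply, Fin.succ_zero_eq_one]
    rw [e1, e2, e3, h0, conjTranspose_one, Matrix.mul_one, Matrix.one_mul]
  have hN0 : D 1 * (D 1)ᴴ - (D 1)ᴴ * D 1 = 0 := by
    refine (PosSemidef.trace_eq_zero_iff (A := D 1 * (D 1)ᴴ - (D 1)ᴴ * D 1) ?_).1 ?_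
    · have hsub : D 1 * (D 1)ᴴ - (D 1)ᴴ * D 1 =
          Q.submatrix (fun j => ((0 : Fin 2), j)) fun j => ((0 : Fin 2), j) := by
        ext j l
        exact (hQ0 0 j l).symm
      rw [hsub]
      exact hQ.submatrix _
    · rw [trace_sub, trace_mul_comm, sub_self]
  have hC : ∀ k : Fin 2, D k.succ * (D 1)ᴴ = (D 1)ᴴ * D k.succ := by
    intro k
    rw [← sub_eq_zero]
    ext j l
    rw [← hQ0]
    exact (hQ.apply_eq_zero_of_diag (by rw [hQ0]; exact congrFun (congrFun hN0 j) j) _).2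
  obtain ⟨U, d, hU, hU', hN⟩ := exists_unitary_diagonal (hC 0)
  have hloc : _root_.loc 1 Uᴴ (blockGram D + vecMulVec (prodVec (Pi.single 2 1 : Fin 3 → ℂ) ψ)
      (star (prodVec (Pi.single 2 1) ψ))) = blockGram (fun i => Uᴴ * D i * U) +
        vecMulVec (prodVec (Pi.single 2 1 : Fin 3 → ℂ) (Uᴴ *ᵥ ψ))
          (star (prodVec (Pi.single 2 1) (Uᴴ *ᵥ ψ))) := by
    rw [loc_add, loc_blockGram, loc_vecMulVec, kronecker_mulVec_prodVec, one_mulVec,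
      blockGram_mul_right _ hU']
    simp [one_apply]
  refine Separable.of_loc (S := 1) (T := Uᴴ) 1 U (Matrix.one_mul 1) hU' ?_
  have hD1 : Uᴴ * D 1 * U = diagonal d := by
    rw [show D 1 = U * diagonal d * Uᴴ from hN, Matrix.mul_assoc, Matrix.mul_assoc, hU,
      Matrix.mul_one, ← Matrix.mul_assoc, hU, Matrix.one_mul]
  have hD2 : (Uᴴ * D 2 * U) * diagonal (star d) = diagonal (star d) * (Uᴴ * D 2 * U) := by
    rw [← diagonal_conjTranspose, ← hD1]
    simp only [conjTranspose_mul, conjTranspose_conjTranspose]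
    calc Uᴴ * D 2 * U * (Uᴴ * ((D 1)ᴴ * U)) = Uᴴ * (D 2 * (U * Uᴴ) * (D 1)ᴴ) * U := by
          simp only [Matrix.mul_assoc]
      _ = Uᴴ * ((D 1)ᴴ * (U * Uᴴ) * D 2) * U := by
          rw [hU', Matrix.mul_one, Matrix.mul_one, show D 2 * _ = _ from hC 1]
          rfl
      _ = _ := by simp only [Matrix.mul_assoc]
  have hP := h.loc (1 : Matrix (Fin 3) (Fin 3) ℂ) Uᴴ
  rw [hloc] at hP
  rw [hloc]
  refine hP.separable_of_diagonal (by simp [h0, hU]) hD1 fun j l hjl => ?_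
  have := congrFun (congrFun hD2 j) l
  rw [mul_diagonal, diagonal_mul] at this
  have hne : star d j - star d l ≠ 0 := sub_ne_zero.2 fun he => hjl (star_injective he)
  exact (mul_eq_zero.1 (by linear_combination -this :
    (star d j - star d l) * (Uᴴ * D 2 * U) j l = 0)).resolve_left hne

end Invertible

section Main

variable {n m r : ℕ}

lemma blockGram_mulVec_prodVec (D : Fin n → Matrix (Fin m) (Fin r) ℂ) (φ : Fin n → ℂ)
    (b : Fin m → ℂ) :
    blockGram D *ᵥ prodVec φ b = fun x => (D x.1 *ᵥ ∑ k, φ k • ((D k)ᴴ *ᵥ b)) x.2 := by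
  ext ⟨i, j⟩
  simp only [mulVec_sum, mulVec_smul, mulVec_mulVec, Finset.sum_apply, Pi.smul_apply]
  simp only [mulVec, dotProduct, Fintype.sum_prod_type, blockGram, of_apply, prodVec,
    Finset.mul_sum, smul_eq_mul]
  exact Finset.sum_congr rfl fun _ _ => Finset.sum_congr rfl fun _ _ => by ring

lemma pt_blockGram_mulVec_prodVec (D : Fin n → Matrix (Fin m) (Fin r) ℂ) (φ : Fin n → ℂ)
    (b : Fin m → ℂ) :
    pt (blockGram D) *ᵥ prodVec φ b =
      fun x => ((∑ k, φ k • D k) *ᵥ ((D x.1)ᴴ *ᵥ b)) x.2 := by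
  ext ⟨i, j⟩
  rw [Matrix.mulVec_mulVec, Matrix.sum_mul]
  simp only [mulVec, dotProduct, Fintype.sum_prod_type, blockGram, pt, of_apply, prodVec,
    Matrix.sum_apply, Matrix.smul_mul, Matrix.smul_apply, Finset.sum_mul, smul_eq_mul]
  rw [Finset.sum_comm]
  exact Finset.sum_congr rfl fun _ _ => Finset.sum_congr rfl fun _ _ => by ring

lemma star_prodVec_dotProduct_pt_mulVec (ρ : Matrix (Fin n × Fin m) (Fin n × Fin m) ℂ)
    (φ : Fin n → ℂ) (b : Fin m → ℂ) :
    star (prodVec (star φ) b) ⬝ᵥ pt ρ *ᵥ prodVec (star φ) b =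
      star (prodVec φ b) ⬝ᵥ ρ *ᵥ prodVec φ b := by
  have h1 := star_dotProduct_mulVec_eq_sum_block ρ fun i => φ i • b
  have h2 := star_dotProduct_mulVec_eq_sum_block (pt ρ) fun i => star (φ i) • b
  refine h2.trans (Eq.trans ?_ h1.symm)
  rw [Finset.sum_comm]
  refine Finset.sum_congr rfl fun i _ => Finset.sum_congr rfl fun k _ => ?_
  simp only [block_pt, star_smul, star_star, smul_dotProduct, mulVec_smul, dotProduct_smul,
    smul_eq_mul]
  ring

/-- More than `n` pairwise orthogonal vectors in `ℂⁿ` cannot all be nonzero. -/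
lemma exists_eq_zero_of_orthogonal (hnm : n < m) (y : Fin m → Fin n → ℂ)
    (h : ∀ s t, s ≠ t → star (y s) ⬝ᵥ y t = 0) : ∃ t, y t = 0 := by
  by_contra! hy
  have hli : LinearIndependent ℂ y := by
    refine Fintype.linearIndependent_iff.2 fun c hc s => ?_
    have := congrArg (star (y s) ⬝ᵥ ·) hc
    simp only [dotProduct_sum, dotProduct_smul, dotProduct_zero] at this
    rw [Finset.sum_eq_single s (fun t _ hts => by rw [h s t hts.symm, smul_zero]) (by simp)] at this
    exact (smul_eq_zero.1 this).resolve_right fun h0 => hy s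
      (dotProduct_star_self_eq_zero.1 h0)
  have := hli.fintype_card_le_finrank
  simp at this
  omega

variable {D : Fin 3 → Matrix (Fin 3) (Fin 3) ℂ} {ψ : Fin 3 → ℂ}

lemma IsPPT.separable_of_forall_det_eq_zero
    (h : IsPPT (blockGram D +
      vecMulVec (prodVec (Pi.single 2 1 : Fin 3 → ℂ) ψ) (star (prodVec (Pi.single 2 1) ψ))))
    (hdet : ∀ t : Fin 4, (D 0 + ((t : ℕ) : ℂ) • D 1).det = 0) :
    Separable (blockGram D +
      vecMulVec (prodVec (Pi.single 2 1 : Fin 3 → ℂ) ψ) (star (prodVec (Pi.single 2 1) ψ))) := by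
  have hker : ∀ φ b : Fin 3 → ℂ, φ 2 = 0 → vecMulVec (prodVec (Pi.single 2 1 : Fin 3 → ℂ) ψ)
      (star (prodVec (Pi.single 2 1) ψ)) *ᵥ prodVec φ b = 0 := by
    intro φ b hφ
    rw [vecMulVec_mulVec, star_prodVec, prodVec_dotProduct_prodVec]
    simp [hφ]
  have hex : ∀ t : Fin 4, ∃ b ≠ 0, (D 0)ᴴ *ᵥ b = -(((t : ℕ) : ℂ) • (D 1)ᴴ *ᵥ b) := by
    intro t
    obtain ⟨b, hb, h0⟩ := exists_mulVec_eq_zero_iff.2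
      (show (D 0 + ((t : ℕ) : ℂ) • D 1)ᴴ.det = 0 by rw [det_conjTranspose, hdet, star_zero])
    refine ⟨b, hb, eq_neg_of_add_eq_zero_left ?_⟩
    rw [← h0, conjTranspose_add, conjTranspose_smul, add_mulVec, smul_mulVec]
    simp
  choose b hb h0 using hex
  have hy : ∀ t : Fin 4, (D 0 + ((t : ℕ) : ℂ) • D 1) *ᵥ ((D 1)ᴴ *ᵥ b t) = 0 := by
    intro t
    set φ : Fin 3 → ℂ := ![1, ((t : ℕ) : ℂ), 0] with hφ
    have hφs : star φ = φ := by
      ext i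
      fin_cases i <;> simp [hφ]
    have hρ : (blockGram D + vecMulVec (prodVec (Pi.single 2 1 : Fin 3 → ℂ) ψ)
        (star (prodVec (Pi.single 2 1) ψ))) *ᵥ prodVec φ (b t) = 0 := by
      rw [add_mulVec, hker φ _ rfl, add_zero, blockGram_mulVec_prodVec]
      ext x
      simp [Fin.sum_univ_three, hφ, h0]
    have hpt := h.2.mulVec_eq_zero (y := prodVec φ (b t)) (by
      rw [← hφs, star_prodVec_dotProduct_pt_mulVec, hρ, dotProduct_zero])
    rw [pt_add, pt_vecMulVec_prodVec, show star (Pi.single 2 1 : Fin 3 → ℂ) = Pi.single 2 1 by simp,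
      add_mulVec, hker φ _ rfl, add_zero, pt_blockGram_mulVec_prodVec] at hpt
    ext j
    simpa [Fin.sum_univ_three, hφ] using congrFun hpt (1, j)
  obtain ⟨t, ht⟩ := exists_eq_zero_of_orthogonal (by decide : 3 < 4) (fun t => (D 1)ᴴ *ᵥ b t) (by
    intro s t hst
    have h1 := congrArg (star (b s) ⬝ᵥ ·) (hy t)
    simp only [dotProduct_zero] at h1
    rw [dotProduct_mulVec, ← conjTranspose_conjTranspose (D 0 + _), ← star_mulVec,
      conjTranspose_add, conjTranspose_smul, add_mulVec, smul_mulVec, h0] at h1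
    have h2 : (((t : ℕ) : ℂ) - ((s : ℕ) : ℂ)) * (star ((D 1)ᴴ *ᵥ b s) ⬝ᵥ (D 1)ᴴ *ᵥ b t) = 0 := by
      rw [← h1]
      simp [add_dotProduct]
      ring
    refine (mul_eq_zero.1 h2).resolve_left (sub_ne_zero.2 fun he => hst ?_)
    exact Fin.ext (Nat.cast_injective he).symm)
  refine h.separable_of_mulVec_eq_zero (fun σ hσ => hσ.separable_three_two) 2 (hb t) fun i hi => ?_
  rw [add_mulVec, hker _ _ (Pi.single_eq_of_ne hi.symm _), add_zero, blockGram_mulVec_prodVec]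
  have hi0 : (D i)ᴴ *ᵥ b t = 0 := by
    have ht' : (D 1)ᴴ *ᵥ b t = 0 := ht
    fin_cases i
    · simpa [ht'] using h0 t
    · exact ht'
    · exact absurd rfl hi
  ext x
  simp [Pi.single_apply, hi0]

lemma IsPPT.separable_of_blockGram_add
    (h : IsPPT (blockGram D +
      vecMulVec (prodVec (Pi.single 2 1 : Fin 3 → ℂ) ψ) (star (prodVec (Pi.single 2 1) ψ)))) :
    Separable (blockGram D +
      vecMulVec (prodVec (Pi.single 2 1 : Fin 3 → ℂ) ψ) (star (prodVec (Pi.single 2 1) ψ))) := by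
  by_cases hdet : ∀ t : Fin 4, (D 0 + ((t : ℕ) : ℂ) • D 1).det = 0
  · exact h.separable_of_forall_det_eq_zero hdet
  push Not at hdet
  obtain ⟨t, ht⟩ := hdet
  set c : ℂ := ((t : ℕ) : ℂ)
  have hu : IsUnit (D 0 + c • D 1).det := isUnit_iff_ne_zero.2 ht
  set S : Matrix (Fin 3) (Fin 3) ℂ := !![1, c, 0; 0, 1, 0; 0, 0, 1] with hS
  have hSS : !![1, -c, 0; 0, 1, 0; 0, 0, 1] * S = 1 := by
    ext i k
    fin_cases i <;> fin_cases k <;> simp [hS, mul_apply, Fin.sum_univ_three]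
  have hS2 : S *ᵥ Pi.single 2 1 = Pi.single 2 1 := by
    ext i
    fin_cases i <;> simp [hS]
  refine Separable.of_loc (T := (D 0 + c • D 1)⁻¹) _ _ hSS (mul_nonsing_inv _ hu) ?_
  have hP := h.loc S (D 0 + c • D 1)⁻¹
  rw [loc_add, loc_blockGram, loc_vecMulVec, kronecker_mulVec_prodVec, hS2] at hP ⊢
  refine hP.separable_of_apply_zero_eq_one ?_
  rw [← nonsing_inv_mul _ hu]
  simp [Fin.sum_univ_three, hS]

lemma rank_lt_rank_of_ker_lt {ι : Type*} [Fintype ι] {M N : Matrix ι ι ℂ}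
    (h : ∀ v, M *ᵥ v = 0 → N *ᵥ v = 0) {x : ι → ℂ} (hN : N *ᵥ x = 0) (hM : M *ᵥ x ≠ 0) :
    N.rank < M.rank := by
  have hlt : LinearMap.ker M.mulVecLin < LinearMap.ker N.mulVecLin :=
    lt_of_le_of_ne (fun v hv => h v hv) fun he => hM (he.ge hN)
  have h1 := Submodule.finrank_lt_finrank_of_lt hlt
  have h2 := M.mulVecLin.finrank_range_add_finrank_ker
  have h3 := N.mulVecLin.finrank_range_add_finrank_ker
  simp only [Matrix.rank]
  omega

/-- A PPT state of rank at most four with a product vector in its range is separable. -/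
lemma IsPPT.separable_of_mulVec_eq_prodVec {ρ : Matrix (Fin 3 × Fin 3) (Fin 3 × Fin 3) ℂ}
    (h : IsPPT ρ) (hr : ρ.rank ≤ 4) {φ : Fin 3 → ℂ} (hφ : φ ≠ 0) (hψ : ψ ≠ 0)
    {x : Fin 3 × Fin 3 → ℂ} (hx : ρ *ᵥ x = prodVec φ ψ) : Separable ρ := by
  have hz : ρ *ᵥ x ≠ 0 := by
    obtain ⟨i, hi⟩ := Function.ne_iff.1 hφ
    obtain ⟨j, hj⟩ := Function.ne_iff.1 hψ
    rw [hx]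
    exact Function.ne_iff.2 ⟨(i, j), mul_ne_zero hi hj⟩
  have hσ := h.1.sub_vecMulVec x
  have hc0 := h.1.dotProduct_mulVec_nonneg x
  set c := star x ⬝ᵥ ρ *ᵥ x with hc
  have hcne : c ≠ 0 := fun h0 => hz (h.1.mulVec_eq_zero h0)
  have hstar : ∀ v, star (ρ *ᵥ x) ⬝ᵥ v = star x ⬝ᵥ ρ *ᵥ v := fun v => by
    rw [star_mulVec, h.1.1, dotProduct_mulVec]
  have hrank : (ρ - c⁻¹ • vecMulVec (ρ *ᵥ x) (star (ρ *ᵥ x))).rank ≤ 3 := by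
    refine Nat.le_of_lt_succ (lt_of_lt_of_le (rank_lt_rank_of_ker_lt ?_ ?_ hz) hr)
    · intro v hv
      rw [sub_mulVec, hv, smul_mulVec, vecMulVec_mulVec, hstar, hv]
      simp
    · rw [sub_mulVec, smul_mulVec, vecMulVec_mulVec, hstar, ← hc]
      ext p
      simp [hcne]
  obtain ⟨W, hW⟩ := hσ.exists_factor_of_rank_le hrank
  obtain ⟨s, hs⟩ : ∃ s : ℂ, c⁻¹ = s * star s := by
    refine ⟨((√(c.re⁻¹) : ℝ) : ℂ), ?_⟩
    have hre : 0 ≤ c.re := (Complex.le_def.1 hc0).1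
    have him : c = (c.re : ℂ) := Complex.ext rfl (by simpa using (Complex.le_def.1 hc0).2.symm)
    rw [Complex.star_def, Complex.conj_ofReal, ← Complex.ofReal_mul,
      Real.mul_self_sqrt (inv_nonneg.2 hre), Complex.ofReal_inv, ← him]
  have hρ : ρ = blockGram (fun i => of fun j a => W (i, j) a) +
      vecMulVec (prodVec φ (s • ψ)) (star (prodVec φ (s • ψ))) := by
    rw [blockGram_eq]
    have : prodVec φ (s • ψ) = s • prodVec φ ψ := by
      ext p
      simp [prodVec]
      ring
    rw [this, star_smul, smul_vecMulVec, vecMulVec_smul, smul_smul, ← hs, ← hx]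
    exact sub_eq_iff_eq_add.1 hW
  obtain ⟨T, T', hT'T, hTT', hT⟩ := exists_basis_change hφ 2
  have hT2 : T' *ᵥ φ = Pi.single 2 1 := by
    rw [← hT, mulVec_mulVec, hT'T, one_mulVec]
  refine Separable.of_loc (S := T') (T := 1) T 1 hTT' (Matrix.one_mul 1) ?_
  have hP := h.loc T' (1 : Matrix (Fin 3) (Fin 3) ℂ)
  rw [hρ, loc_add, loc_blockGram, loc_vecMulVec, kronecker_mulVec_prodVec, hT2] at hP ⊢
  exact hP.separable_of_blockGram_add

end Main

end PPT

theorem stmt10 (ρ : Matrix (Fin 3 × Fin 3) (Fin 3 × Fin 3) ℂ)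
    (hne : ρ ≠ 0) (hpsd : ρ.PosSemidef) (hppt : (pt ρ).PosSemidef)
    (hrank : ρ.rank = 4) (hsep : ¬ Separable ρ) :
    ¬ ∃ (φ ψ : Fin 3 → ℂ), φ ≠ 0 ∧ ψ ≠ 0 ∧
      (∃ x, ρ.mulVec x = prodVec φ ψ) ∧
      (∃ y, (pt ρ).mulVec y = prodVec (star φ) ψ) := by
  rintro ⟨φ, ψ, hφ, hψ, ⟨x, hx⟩, -⟩
  exact hsep (IsPPT.separable_of_mulVec_eq_prodVec ⟨hpsd, hppt⟩ hrank.le hφ hψ hx)
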